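/- arXiv:2504.03788 — 4 statements merged into one kernel-verified Lean document; each statement's English description precedes it below -/
import Mathlib

section
/- Let n ≥ 1, T > 0, and let F : ℝ × ℝⁿ → ℝⁿ be continuously differentiable and T-periodic in its first variable. Let p : ℝ → ℝⁿ be a T-periodic solution of x' = F(t, x), and let Φ be the fundamental matrix solution of the variational equation y' = D_x F(t, p(t)) y with Φ(0) = I. If every eigenvalue of Φ(T) has modulus strictly less than 1 (equivalently, every characteristic exponent has negative real part), then p is asymptotically stable: for every ε > 0 there is δ > 0 such that every solution x with |x(0) − p(0)| < δ is defined for all t ≥ 0, satisfies |x(t) − p(t)| < ε for all t ≥ 0, and |x(t) − p(t)| → 0 as t → ∞. -/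
open Set Filter Topology

/-- The Jacobian matrix of a map `G : ℝⁿ → ℝⁿ` at a point `x`. -/
noncomputable def jacobianMatrix (n : ℕ) (G : (Fin n → ℝ) → (Fin n → ℝ))
    (x : Fin n → ℝ) : Matrix (Fin n) (Fin n) ℝ :=
  Matrix.of fun i j => fderiv ℝ G x (Pi.single j 1) i


open scoped NNReal ENNReal

section
variable {E : Type*} [NormedAddCommGroup E] [NormedSpace ℝ E]

theorem PS_global_exists [CompleteSpace E] (g : ℝ → E → E) (K L : ℝ≥0)
    (hlip : ∀ t, LipschitzWith K (g t)) (hcont : ∀ x, Continuous fun t => g t x)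
    (hbd : ∀ t x, ‖g t x‖ ≤ L) (x₀ : E) :
    ∃ w : ℝ → E, w 0 = x₀ ∧ ∀ t, HasDerivAt w (g t (w t)) t := by
  have h1 : ∀ N : ℕ, ∃ α : ℝ → E, α 0 = x₀ ∧
      ∀ t ∈ Ioo (-((N : ℝ) + 1)) ((N : ℝ) + 1), HasDerivAt α (g t (α t)) t := by
    intro N
    have hN : (0 : ℝ) ≤ N := Nat.cast_nonneg N
    have hpl : IsPicardLindelof g
        (⟨0, by constructor <;> linarith⟩ : Icc (-((N : ℝ) + 1)) ((N : ℝ) + 1)) x₀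
        (L * (N + 1)) 0 L K :=
      { lipschitzOnWith := fun t _ => (hlip t).lipschitzOnWith
        continuousOn := fun x _ => (hcont x).continuousOn
        norm_le := fun t _ x _ => hbd t x
        mul_max_le := by simp }
    obtain ⟨α, h0, hα⟩ := hpl.exists_eq_forall_mem_Icc_hasDerivWithinAt₀
    exact ⟨α, h0, fun t ht => (hα t ⟨ht.1.le, ht.2.le⟩).hasDerivAt (Icc_mem_nhds ht.1 ht.2)⟩
  choose α h0 hα using h1
  have hle : ∀ M N : ℕ, M ≤ N → ∀ s : ℝ, |s| < M + 1 → α M s = α N s := by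
    intro M N hMN s hs
    have hM : (0 : ℝ) ≤ M := Nat.cast_nonneg M
    have hMN' : (M : ℝ) ≤ N := by exact_mod_cast hMN
    refine ODE_solution_unique_of_mem_Ioo (v := g) (s := fun _ => univ) (K := K) (t₀ := 0)
      (a := -((M : ℝ) + 1)) (b := M + 1)
      (fun t _ => (hlip t).lipschitzOnWith) ⟨by linarith, by linarith⟩
      (fun t ht => ⟨hα M t ht, trivial⟩)
      (fun t ht => ⟨hα N t ⟨by linarith [ht.1], by linarith [ht.2]⟩, trivial⟩)
      ((h0 M).trans (h0 N).symm) (abs_lt.1 hs)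
  have heq : ∀ M N : ℕ, ∀ s : ℝ, |s| < M + 1 → |s| < N + 1 → α M s = α N s := by
    intro M N s hM hN
    rcases le_total M N with h | h
    · exact hle M N h s hM
    · exact (hle N M h s hN).symm
  have hceil : ∀ s : ℝ, |s| < (⌈|s|⌉₊ : ℝ) + 1 := fun s => by
    linarith [Nat.le_ceil |s|]
  refine ⟨fun t => α ⌈|t|⌉₊ t, h0 _, fun t => ?_⟩
  have hd := hα ⌈|t|⌉₊ t (abs_lt.1 (hceil t))
  refine hd.congr_of_eventuallyEq ?_
  have : ∀ᶠ s in 𝓝 t, |s| < (⌈|t|⌉₊ : ℝ) + 1 :=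
    continuous_abs.continuousAt.eventually_lt continuousAt_const (hceil t)
  filter_upwards [this] with s hs
  exact heq _ _ s (hceil s) hs

theorem PS_growth (g : ℝ → E → E) (K : ℝ) (hg : ∀ t x, ‖g t x‖ ≤ K * ‖x‖)
    (w : ℝ → E) (a b : ℝ) (hw : ∀ t ∈ Icc a b, HasDerivAt w (g t (w t)) t) :
    ∀ t ∈ Icc a b, ‖w t‖ ≤ ‖w a‖ * Real.exp (K * (t - a)) := by
  intro t ht
  have := norm_le_gronwallBound_of_norm_deriv_right_le (f := w) (f' := fun t => g t (w t))
    (δ := ‖w a‖) (K := K) (ε := 0) (a := a) (b := b)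
    (fun s hs => (hw s hs).continuousAt.continuousWithinAt)
    (fun s hs => (hw s ⟨hs.1, hs.2.le⟩).hasDerivWithinAt) le_rfl
    (fun s _ => by simpa using hg s (w s)) t ht
  rwa [gronwallBound_ε0] at this

theorem PS_one_period (g : ℝ → E → E) (A : ℝ → E →L[ℝ] E) (K T η r : ℝ) (hK : 0 < K) (hT : 0 < T)
    (hη : 0 ≤ η)
    (hg : ∀ t x, ‖g t x‖ ≤ K * ‖x‖) (hA : ∀ t, ‖A t‖ ≤ K)
    (hR : ∀ t x, ‖x‖ ≤ r → ‖g t x - A t x‖ ≤ η * ‖x‖)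
    (w u : ℝ → E) (hw : ∀ t ∈ Icc 0 T, HasDerivAt w (g t (w t)) t)
    (hu : ∀ t, HasDerivAt u (A t (u t)) t) (h0 : w 0 = u 0)
    (hsmall : ‖w 0‖ * Real.exp (K * T) ≤ r) :
    ‖w T - u T‖ ≤ η * (Real.exp (K * T)) ^ 2 / K * ‖w 0‖ := by
  have hwb : ∀ t ∈ Icc 0 T, ‖w t‖ ≤ ‖w 0‖ * Real.exp (K * T) := by
    intro t ht
    refine (PS_growth g K hg w 0 T hw t ht).trans ?_
    gcongr
    linarith [ht.2]
  have := norm_le_gronwallBound_of_norm_deriv_right_le (f := fun t => w t - u t)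
    (f' := fun t => g t (w t) - A t (u t))
    (δ := 0) (K := K) (ε := η * (‖w 0‖ * Real.exp (K * T))) (a := 0) (b := T)
    (fun s hs => ((hw s hs).continuousAt.sub (hu s).continuousAt).continuousWithinAt)
    (fun s hs => ((hw s ⟨hs.1, hs.2.le⟩).sub (hu s)).hasDerivWithinAt) (by simp [h0])
    (fun s hs => by
      have hs' : s ∈ Icc 0 T := ⟨hs.1, hs.2.le⟩
      have e : g s (w s) - A s (u s) = A s (w s - u s) + (g s (w s) - A s (w s)) := by
        rw [map_sub]; abel
      rw [e]
      refine (norm_add_le _ _).trans (add_le_add ?_ ?_)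
      · exact ((A s).le_opNorm _).trans (by gcongr; exact hA s)
      · refine (hR s _ ((hwb s hs').trans hsmall)).trans ?_
        gcongr
        exact hwb s hs') T ⟨hT.le, le_rfl⟩
  rw [gronwallBound_of_K_ne_0 hK.ne'] at this
  refine this.trans ?_
  simp only [zero_mul, zero_add, sub_zero]
  have h1 : Real.exp (K * T) - 1 ≤ Real.exp (K * T) := by linarith
  calc η * (‖w 0‖ * Real.exp (K * T)) / K * (Real.exp (K * T) - 1)
      ≤ η * (‖w 0‖ * Real.exp (K * T)) / K * Real.exp (K * T) := by gcongr
    _ = _ := by ring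

theorem PS_stab (g : ℝ → E → E) (K T d : ℝ) (hK : 0 < K) (hT : 0 < T)
    (hper : ∀ t, g (t + T) = g t)
    (hg : ∀ t x, ‖g t x‖ ≤ K * ‖x‖)
    (hone : ∀ w : ℝ → E, (∀ t, 0 ≤ t → HasDerivAt w (g t (w t)) t) → ‖w 0‖ ≤ d →
      ‖w T‖ ≤ 1 / 2 * ‖w 0‖)
    (w : ℝ → E) (hw : ∀ t, 0 ≤ t → HasDerivAt w (g t (w t)) t) (hd : ‖w 0‖ ≤ d) :
    (∀ t, 0 ≤ t → ‖w t‖ ≤ ‖w 0‖ * Real.exp (K * T)) ∧ Tendsto (fun t => ‖w t‖) atTop (𝓝 0) := by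
  have hperk : ∀ (k : ℕ) t, g (t + k * T) = g t := by
    intro k
    induction k with
    | zero => simp
    | succ k ih =>
      intro t
      have : t + ((k + 1 : ℕ) : ℝ) * T = (t + k * T) + T := by push_cast; ring
      rw [this, hper, ih]
  have hk : ∀ k : ℕ, ‖w (k * T)‖ ≤ (1 / 2) ^ k * ‖w 0‖ := by
    intro k
    induction k with
    | zero => simp
    | succ k ih =>
      have h1 := hone (fun t => w (t + k * T)) (fun t ht => by
        have := (hw (t + k * T) (by positivity)).comp_add_const t (k * T)
        rwa [hperk] at this) (by
          simp only [zero_add]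
          refine ih.trans (le_trans ?_ hd)
          exact mul_le_of_le_one_left (norm_nonneg _) (pow_le_one₀ (by norm_num) (by norm_num)))
      simp only [zero_add] at h1
      have e : ((k + 1 : ℕ) : ℝ) * T = T + k * T := by push_cast; ring
      rw [e]
      refine h1.trans ?_
      rw [pow_succ]
      nlinarith
  have hb : ∀ t, 0 ≤ t → ‖w t‖ ≤ (1 / 2) ^ (⌊t / T⌋₊) * ‖w 0‖ * Real.exp (K * T) := by
    intro t ht
    have h1 : (⌊t / T⌋₊ : ℝ) * T ≤ t := by
      rw [← le_div_iff₀ hT]; exact Nat.floor_le (by positivity)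
    have h2 : t ≤ (⌊t / T⌋₊ : ℝ) * T + T := by
      have := (Nat.lt_floor_add_one (t / T)).le
      rw [div_le_iff₀ hT] at this
      linarith
    have h0 : 0 ≤ (⌊t / T⌋₊ : ℝ) * T := by positivity
    have := PS_growth g K hg w (⌊t / T⌋₊ * T) t (fun s hs => hw s (h0.trans hs.1)) t ⟨h1, le_rfl⟩
    refine this.trans ?_
    have h3 := hk ⌊t / T⌋₊
    gcongr
    linarith
  refine ⟨fun t ht => (hb t ht).trans ?_, ?_⟩
  · gcongr
    exact mul_le_of_le_one_left (norm_nonneg _) (pow_le_one₀ (by norm_num) (by norm_num))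
  · have ht : Tendsto (fun t : ℝ => (1 / 2 : ℝ) ^ (⌊t / T⌋₊) * ‖w 0‖ * Real.exp (K * T)) atTop
        (𝓝 0) := by
      have h1 : Tendsto (fun t : ℝ => ⌊t / T⌋₊) atTop atTop :=
        tendsto_nat_floor_atTop.comp (tendsto_id.atTop_div_const hT)
      have h2 := (tendsto_pow_atTop_nhds_zero_of_lt_one (r := (1 / 2 : ℝ)) (by norm_num)
        (by norm_num)).comp h1
      simpa using (h2.mul_const ‖w 0‖).mul_const (Real.exp (K * T))
    refine squeeze_zero' (Eventually.of_forall fun t => norm_nonneg _) ?_ ht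
    filter_upwards [eventually_ge_atTop 0] with t ht using hb t ht
end

section
attribute [local instance] Matrix.linftyOpNormedRing Matrix.linftyOpNormedAlgebra

theorem PS_gelfand (n : ℕ) (hn : 1 ≤ n) (M : Matrix (Fin n) (Fin n) ℝ)
    (hmult : ∀ μ ∈ spectrum ℂ (M.map Complex.ofReal), ‖μ‖ < 1) :
    ∃ m : ℕ, 1 ≤ m ∧ ∀ v : Fin n → ℝ, ‖(M ^ m).mulVec v‖ ≤ 1 / 4 * ‖v‖ := by
  have : Nonempty (Fin n) := ⟨⟨0, hn⟩⟩
  set B : Matrix (Fin n) (Fin n) ℂ := M.map Complex.ofReal with hB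
  have : CompleteSpace (Matrix (Fin n) (Fin n) ℂ) := FiniteDimensional.complete ℂ _
  have hr : spectralRadius ℂ B < (1 : ℝ≥0) :=
    spectrum.spectralRadius_lt_of_forall_lt B (fun z hz => by
      have := hmult z hz
      exact_mod_cast this)
  obtain ⟨c, hc1, hc2⟩ := exists_between hr
  have hc2' : c < 1 := by simpa using hc2
  have hev := (spectrum.pow_nnnorm_pow_one_div_tendsto_nhds_spectralRadius B).eventually_lt_const hc1
  have hpow : ∀ᶠ m : ℕ in atTop, c ^ m < (1 / 4 : ℝ≥0) := by
    have := ENNReal.tendsto_pow_atTop_nhds_zero_of_lt_one hc2'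
    exact this.eventually_lt_const (by simp)
  obtain ⟨m, hm1, hm2, hm3⟩ := (hev.and (hpow.and (eventually_ge_atTop 1))).exists
  have hnorm : ‖B ^ m‖ ≤ 1 / 4 := by
    have hm0 : (m : ℝ) ≠ 0 := by positivity
    have h1 : (‖B ^ m‖₊ : ℝ≥0∞) ≤ c ^ m := by
      have := ENNReal.rpow_le_rpow hm1.le (z := (m : ℝ)) (by positivity)
      rwa [← ENNReal.rpow_mul, one_div_mul_cancel hm0, ENNReal.rpow_one, ENNReal.rpow_natCast]
        at this
    have h2 : (‖B ^ m‖₊ : ℝ≥0∞) < (1 / 4 : ℝ≥0) := h1.trans_lt hm2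
    have h3 : ‖B ^ m‖₊ < (1 / 4 : ℝ≥0) := by exact_mod_cast h2
    have := NNReal.coe_lt_coe.2 h3
    simpa using this.le
  refine ⟨m, hm3, fun v => ?_⟩
  have hmap : B ^ m = (M ^ m).map Complex.ofReal := by
    have := (map_pow (Complex.ofRealHom.mapMatrix (m := Fin n)) M m)
    exact this.symm
  have hnv : ∀ v : Fin n → ℝ, ‖(fun i => (v i : ℂ))‖ = ‖v‖ := by
    intro v
    simp [Pi.norm_def]
  have hmv : (B ^ m).mulVec (fun i => (v i : ℂ)) = fun i => (((M ^ m).mulVec v i : ℝ) : ℂ) := by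
    rw [hmap]
    ext i
    simp [Matrix.mulVec, dotProduct]
  have := Matrix.linfty_opNorm_mulVec (B ^ m) (fun i => (v i : ℂ))
  rw [hmv, hnv, hnv] at this
  exact this.trans (by gcongr)
end

/-- coordinatewise clamping to `[-1, 1]` -/
noncomputable def PSclamp (n : ℕ) (w : Fin n → ℝ) : Fin n → ℝ := fun i => max (-1) (min 1 (w i))

theorem PSclamp_norm (n : ℕ) (w : Fin n → ℝ) : ‖PSclamp n w‖ ≤ 1 := by
  rw [pi_norm_le_iff_of_nonneg zero_le_one]
  intro i
  rw [Real.norm_eq_abs, abs_le]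
  exact ⟨le_max_left _ _, max_le (by norm_num) (min_le_left _ _)⟩

theorem PSclamp_lip (n : ℕ) (w v : Fin n → ℝ) : ‖PSclamp n w - PSclamp n v‖ ≤ ‖w - v‖ := by
  rw [pi_norm_le_iff_of_nonneg (norm_nonneg _)]
  intro i
  refine le_trans ?_ (norm_le_pi_norm (w - v) i)
  simp only [PSclamp, Pi.sub_apply, Real.norm_eq_abs]
  grind

theorem PSclamp_eq (n : ℕ) (w : Fin n → ℝ) (h : ‖w‖ ≤ 1) : PSclamp n w = w := by
  ext i
  have := abs_le.1 ((norm_le_pi_norm w i).trans h)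
  simp [PSclamp, this.1, this.2]

section
variable {E : Type*} [NormedAddCommGroup E] [NormedSpace ℝ E]

/-- partial derivative in the space variable -/
noncomputable def PSD (F : ℝ → E → E) (q : ℝ × E) : E →L[ℝ] E :=
  (fderiv ℝ (fun q : ℝ × E => F q.1 q.2) q).comp (ContinuousLinearMap.inr ℝ ℝ E)

theorem PSD_cont (F : ℝ → E → E) (hF : ContDiff ℝ 1 (fun q : ℝ × E => F q.1 q.2)) :
    Continuous (PSD F) :=
  (hF.continuous_fderiv one_ne_zero).clm_comp continuous_const

theorem PSD_deriv (F : ℝ → E → E) (hF : ContDiff ℝ 1 (fun q : ℝ × E => F q.1 q.2)) (t : ℝ) (x : E) :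
    HasFDerivAt (F t) (PSD F (t, x)) x :=
  ((hF.differentiable one_ne_zero) (t, x)).hasFDerivAt.comp x (hasFDerivAt_prodMk_right t x)

theorem PSD_deriv_add (F : ℝ → E → E) (hF : ContDiff ℝ 1 (fun q : ℝ × E => F q.1 q.2))
    (t : ℝ) (c x : E) : HasFDerivAt (fun x => F t (c + x)) (PSD F (t, c + x)) x := by
  have := (PSD_deriv F hF t (c + x)).comp x ((hasFDerivAt_id x).const_add c)
  rwa [ContinuousLinearMap.comp_id] at this

/-- Lipschitz bound on a tube around a continuous curve. -/
theorem PS_tube_lip [ProperSpace E] (F : ℝ → E → E)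
    (hF : ContDiff ℝ 1 (fun q : ℝ × E => F q.1 q.2))
    (p : ℝ → E) (hp : Continuous p) (a b R : ℝ) :
    ∃ K : ℝ, 1 ≤ K ∧ ∀ t ∈ Icc a b, ∀ x ∈ Metric.closedBall (0 : E) R,
      ‖PSD F (t, p t + x)‖ ≤ K ∧ ∀ y ∈ Metric.closedBall (0 : E) R,
      ‖F t (p t + y) - F t (p t + x)‖ ≤ K * ‖y - x‖ := by
  have hc : Continuous fun q : ℝ × E => PSD F (q.1, p q.1 + q.2) :=
    (PSD_cont F hF).comp (by fun_prop)
  have hcomp : IsCompact (Icc a b ×ˢ Metric.closedBall (0 : E) R) :=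
    isCompact_Icc.prod (isCompact_closedBall _ _)
  obtain ⟨K, hK⟩ := hcomp.exists_bound_of_continuousOn hc.continuousOn
  refine ⟨max 1 K, le_max_left _ _, fun t ht x hx => ⟨(hK (t, x) ⟨ht, hx⟩).trans (le_max_right _ _),
    fun y hy => ?_⟩⟩
  exact (convex_closedBall (0 : E) R).norm_image_sub_le_of_norm_hasFDerivWithin_le
    (f := fun x => F t (p t + x)) (f' := fun x => PSD F (t, p t + x))
    (fun x _ => (PSD_deriv_add F hF t (p t) x).hasFDerivWithinAt)
    (fun x hx => (hK (t, x) ⟨ht, hx⟩).trans (le_max_right _ _)) hx hy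

/-- Uniform first-order expansion along a continuous curve. -/
theorem PS_tube_small [ProperSpace E] (F : ℝ → E → E)
    (hF : ContDiff ℝ 1 (fun q : ℝ × E => F q.1 q.2))
    (p : ℝ → E) (hp : Continuous p) (a b η : ℝ) (hη : 0 < η) :
    ∃ r : ℝ, 0 < r ∧ r ≤ 1 ∧ ∀ t ∈ Icc a b, ∀ x : E, ‖x‖ ≤ r →
      ‖F t (p t + x) - F t (p t) - PSD F (t, p t) x‖ ≤ η * ‖x‖ := by
  have hc : Continuous fun q : ℝ × E => PSD F (q.1, p q.1 + q.2) :=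
    (PSD_cont F hF).comp (by fun_prop)
  have hcomp : IsCompact (Icc a b ×ˢ Metric.closedBall (0 : E) 1) :=
    isCompact_Icc.prod (isCompact_closedBall _ _)
  have huc := hcomp.uniformContinuousOn_of_continuous hc.continuousOn
  obtain ⟨δ, hδ, H⟩ := Metric.uniformContinuousOn_iff_le.1 huc η hη
  refine ⟨min δ 1, lt_min hδ one_pos, min_le_right _ _, fun t ht x hx => ?_⟩
  have hb : ∀ y ∈ Metric.closedBall (0 : E) (min δ 1),
      ‖PSD F (t, p t + y) - PSD F (t, p t)‖ ≤ η := by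
    intro y hy
    rw [mem_closedBall_zero_iff] at hy
    have := H (t, y) ⟨ht, by simpa using hy.trans (min_le_right _ _)⟩ (t, 0) ⟨ht, by simp⟩
      (by simpa [Prod.dist_eq] using hy.trans (min_le_left _ _))
    simpa [dist_eq_norm] using this
  have := (convex_closedBall (0 : E) (min δ 1)).norm_image_sub_le_of_norm_hasFDerivWithin_le'
    (f := fun x => F t (p t + x)) (f' := fun x => PSD F (t, p t + x)) (φ := PSD F (t, p t))
    (x := 0) (y := x)
    (fun x _ => (PSD_deriv_add F hF t (p t) x).hasFDerivWithinAt)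
    hb (by simp [hδ.le]) (by simpa using hx)
  simpa using this

/-- Forward uniqueness. -/
theorem PS_unique [ProperSpace E] (F : ℝ → E → E)
    (hF : ContDiff ℝ 1 (fun q : ℝ × E => F q.1 q.2)) (z y : ℝ → E)
    (hz : ∀ t, 0 ≤ t → HasDerivAt z (F t (z t)) t)
    (hy : ∀ t, 0 ≤ t → HasDerivAt y (F t (y t)) t) (h0 : z 0 = y 0) :
    ∀ t, 0 ≤ t → z t = y t := by
  intro t ht
  have hzc : ContinuousOn z (Icc 0 t) := fun s hs => (hz s hs.1).continuousAt.continuousWithinAt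
  have hyc : ContinuousOn y (Icc 0 t) := fun s hs => (hy s hs.1).continuousAt.continuousWithinAt
  obtain ⟨R1, hR1⟩ := isCompact_Icc.exists_bound_of_continuousOn hzc
  obtain ⟨R2, hR2⟩ := isCompact_Icc.exists_bound_of_continuousOn hyc
  obtain ⟨K, hK1, hK⟩ := PS_tube_lip F hF (fun _ => 0) continuous_const 0 t (max R1 R2)
  refine ODE_solution_unique_of_mem_Icc_right (v := F) (K := K.toNNReal)
    (s := fun _ => Metric.closedBall (0 : E) (max R1 R2)) (a := 0) (b := t) ?_ hzc
    (fun s hs => (hz s hs.1).hasDerivWithinAt) ?_ hyc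
    (fun s hs => (hy s hs.1).hasDerivWithinAt) ?_ h0 ⟨ht, le_rfl⟩
  · intro s hs
    rw [lipschitzOnWith_iff_norm_sub_le]
    intro x hx y hy
    rw [Real.coe_toNNReal K (by linarith)]
    simpa using (hK s ⟨hs.1, hs.2.le⟩ y hy).2 x hx
  · intro s hs
    simpa using Or.inl (hR1 s ⟨hs.1, hs.2.le⟩)
  · intro s hs
    simpa using Or.inr (hR2 s ⟨hs.1, hs.2.le⟩)
end

/-- Key theorem with a contracting fundamental solution over one period. -/
theorem PS_key (n : ℕ) (T : ℝ) (hT : 0 < T)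
    (F : ℝ → (Fin n → ℝ) → (Fin n → ℝ))
    (hF : ContDiff ℝ 1 (fun q : ℝ × (Fin n → ℝ) => F q.1 q.2))
    (hFper : ∀ t, F (t + T) = F t)
    (p : ℝ → Fin n → ℝ)
    (hp : ∀ t, HasDerivAt p (F t (p t)) t)
    (hpper : ∀ t, p (t + T) = p t)
    (U : ℝ → (Fin n → ℝ) → (Fin n → ℝ)) (hU0 : ∀ v, U 0 v = v)
    (hU : ∀ v t, HasDerivAt (fun s => U s v) (PSD F (t, p t) (U t v)) t)
    (hUT : ∀ v, ‖U T v‖ ≤ 1 / 4 * ‖v‖) :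
    ∀ ε > 0, ∃ δ > 0, ∀ x₀ : Fin n → ℝ, ‖x₀ - p 0‖ < δ →
      (∃ z : ℝ → Fin n → ℝ, z 0 = x₀ ∧
        (∀ t, 0 ≤ t → HasDerivAt z (F t (z t)) t)) ∧
      (∀ z : ℝ → Fin n → ℝ, z 0 = x₀ →
        (∀ t, 0 ≤ t → HasDerivAt z (F t (z t)) t) →
        (∀ t, 0 ≤ t → ‖z t - p t‖ < ε) ∧
        Tendsto (fun t => ‖z t - p t‖) atTop (𝓝 0)) := by
  intro ε hε
  have hpc : Continuous p := continuous_iff_continuousAt.2 fun t => (hp t).continuousAt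
  obtain ⟨K, hK1, hK⟩ := PS_tube_lip F hF p hpc 0 T 1
  have hK0 : 0 < K := by linarith
  set g : ℝ → (Fin n → ℝ) → (Fin n → ℝ) :=
    fun t w => F t (p t + PSclamp n w) - F t (p t) with hgdef
  have hred : ∀ t, ∃ s ∈ Icc 0 T, F t = F s ∧ p t = p s ∧ PSD F (t, p t) = PSD F (s, p s) := by
    intro t
    have hper : Function.Periodic (fun t => (F t, p t)) T := fun t => by
      simp only [hFper, hpper]
    obtain ⟨s, hs, h⟩ := hper.exists_mem_Ico₀ hT t
    simp only [Prod.mk.injEq] at h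
    refine ⟨s, ⟨hs.1, hs.2.le⟩, h.1, h.2, ?_⟩
    have h1 := PSD_deriv F hF t (p t)
    rw [h.1, h.2] at h1
    rw [h.2]
    exact h1.unique (PSD_deriv F hF s (p s))
  have hlip : ∀ t x y, ‖g t x - g t y‖ ≤ K * ‖x - y‖ := by
    intro t x y
    obtain ⟨s, hs, h1, h2, -⟩ := hred t
    have := (hK s hs (PSclamp n y) (by simpa using PSclamp_norm n y)).2 (PSclamp n x)
      (by simpa using PSclamp_norm n x)
    simp only [hgdef, h1, h2, sub_sub_sub_cancel_right]
    refine this.trans ?_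
    gcongr
    exact PSclamp_lip n x y
  have hc0 : PSclamp n 0 = 0 := PSclamp_eq n 0 (by simp)
  have hg0 : ∀ t, g t 0 = 0 := fun t => by simp [hgdef, hc0]
  have hgK : ∀ t x, ‖g t x‖ ≤ K * ‖x‖ := fun t x => by
    simpa [hg0] using hlip t x 0
  have hgc : ∀ t x, g t x = g t (PSclamp n x) := fun t x => by
    simp only [hgdef]
    rw [PSclamp_eq n (PSclamp n x) (PSclamp_norm n x)]
  have hgbd : ∀ t x, ‖g t x‖ ≤ K := fun t x => by
    rw [hgc]
    refine (hgK _ _).trans ?_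
    exact mul_le_of_le_one_right hK0.le (PSclamp_norm n x)
  have hFc : Continuous (fun q : ℝ × (Fin n → ℝ) => F q.1 q.2) := hF.continuous
  have hgcont : ∀ x, Continuous fun t => g t x := fun x => by
    have h1 : Continuous fun t => F t (p t + PSclamp n x) :=
      hFc.comp (f := fun t => (t, p t + PSclamp n x)) (by fun_prop)
    have h2 : Continuous fun t => F t (p t) :=
      hFc.comp (f := fun t => (t, p t)) (by fun_prop)
    exact h1.sub h2
  have hA : ∀ t, ‖PSD F (t, p t)‖ ≤ K := fun t => by
    obtain ⟨s, hs, -, -, h3⟩ := hred t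
    rw [h3]
    simpa using (hK s hs 0 (by simp)).1
  have hgper : ∀ t, g (t + T) = g t := fun t => by
    simp only [hgdef, hFper, hpper]
  set X := Real.exp (K * T) with hX
  have hXpos : 0 < X := Real.exp_pos _
  obtain ⟨r, hr0, hr1, hr⟩ := PS_tube_small F hF p hpc 0 T (K / (4 * X ^ 2)) (by positivity)
  have hR : ∀ t x, ‖x‖ ≤ r → ‖g t x - PSD F (t, p t) x‖ ≤ K / (4 * X ^ 2) * ‖x‖ := by
    intro t x hx
    obtain ⟨s, hs, h1, h2, h3⟩ := hred t
    rw [h3]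
    simp only [hgdef, h1, h2]
    rw [PSclamp_eq n x (hx.trans hr1)]
    exact hr s hs x hx
  have hone : ∀ w : ℝ → (Fin n → ℝ), (∀ t, 0 ≤ t → HasDerivAt w (g t (w t)) t) → ‖w 0‖ ≤ r / X →
      ‖w T‖ ≤ 1 / 2 * ‖w 0‖ := by
    intro w hw hw0
    have h1 := PS_one_period g (fun t => PSD F (t, p t)) K T (K / (4 * X ^ 2)) r hK0 hT
      (by positivity) hgK hA hR w (fun t => U t (w 0)) (fun t ht => hw t ht.1) (hU (w 0))
      (hU0 _).symm (by rwa [← le_div_iff₀ hXpos])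
    have e : K / (4 * X ^ 2) * X ^ 2 / K = 1 / 4 := by field_simp
    rw [← hX, e] at h1
    have h2 := hUT (w 0)
    have h3 := norm_add_le (w T - U T (w 0)) (U T (w 0))
    rw [sub_add_cancel] at h3
    linarith
  refine ⟨min (r / X) (ε / X), by positivity, fun x₀ hx₀ => ?_⟩
  have hd1 : ‖x₀ - p 0‖ < r / X := hx₀.trans_le (min_le_left _ _)
  have hd2 : ‖x₀ - p 0‖ < ε / X := hx₀.trans_le (min_le_right _ _)
  obtain ⟨w, hw0, hw⟩ := PS_global_exists g K.toNNReal K.toNNReal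
    (fun t => LipschitzWith.of_dist_le_mul fun x y => by
      rw [Real.coe_toNNReal K hK0.le]
      simpa [dist_eq_norm] using hlip t x y) hgcont
    (by rw [Real.coe_toNNReal K hK0.le]; exact hgbd) (x₀ - p 0)
  obtain ⟨hb, hlim⟩ := PS_stab g K T (r / X) hK0 hT hgper hgK hone w (fun t _ => hw t)
    (by rw [hw0]; exact hd1.le)
  rw [hw0, ← hX] at hb
  have hwr : ∀ t, 0 ≤ t → ‖w t‖ ≤ 1 := fun t ht =>
    ((hb t ht).trans ((le_div_iff₀ hXpos).1 hd1.le)).trans hr1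
  have hy : ∀ t, 0 ≤ t → HasDerivAt (fun s => p s + w s) (F t (p t + w t)) t := by
    intro t ht
    have := (hp t).add (hw t)
    simp only [hgdef] at this
    rwa [PSclamp_eq n _ (hwr t ht), add_sub_cancel] at this
  have hy0 : p 0 + w 0 = x₀ := by rw [hw0]; abel
  refine ⟨⟨fun s => p s + w s, hy0, hy⟩, fun z hz0 hz => ?_⟩
  have hzy := PS_unique F hF z (fun s => p s + w s) hz hy (hz0.trans hy0.symm)
  have hzw : ∀ t, 0 ≤ t → ‖z t - p t‖ = ‖w t‖ := fun t ht => by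
    rw [hzy t ht, add_sub_cancel_left]
  refine ⟨fun t ht => ?_, ?_⟩
  · rw [hzw t ht]
    exact (hb t ht).trans_lt ((lt_div_iff₀ hXpos).1 hd2)
  · refine hlim.congr' ?_
    filter_upwards [eventually_ge_atTop 0] with t ht using (hzw t ht).symm
/-- If all characteristic multipliers (eigenvalues of the monodromy
matrix of the variational equation along a `T`-periodic solution `p`) have
modulus `< 1`, then `p` is asymptotically stable. -/
theorem periodic_solution_asymptotically_stable
    (n : ℕ) (hn : 1 ≤ n) (T : ℝ) (hT : 0 < T)
    (F : ℝ → (Fin n → ℝ) → (Fin n → ℝ))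
    (hF : ContDiff ℝ 1 (fun q : ℝ × (Fin n → ℝ) => F q.1 q.2))
    (hFper : ∀ t x, F (t + T) x = F t x)
    (p : ℝ → Fin n → ℝ)
    (hp : ∀ t, HasDerivAt p (F t (p t)) t)
    (hpper : ∀ t, p (t + T) = p t)
    (Φ : ℝ → Matrix (Fin n) (Fin n) ℝ)
    (hΦ0 : Φ 0 = 1)
    (hΦ : ∀ t i j, HasDerivAt (fun s => Φ s i j)
      ((jacobianMatrix n (fun x => F t x) (p t) * Φ t) i j) t)
    (hmult : ∀ μ ∈ spectrum ℂ ((Φ T).map Complex.ofReal), ‖μ‖ < 1) :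
    ∀ ε > 0, ∃ δ > 0, ∀ x₀ : Fin n → ℝ, ‖x₀ - p 0‖ < δ →
      (∃ z : ℝ → Fin n → ℝ, z 0 = x₀ ∧
        (∀ t, 0 ≤ t → HasDerivAt z (F t (z t)) t)) ∧
      (∀ z : ℝ → Fin n → ℝ, z 0 = x₀ →
        (∀ t, 0 ≤ t → HasDerivAt z (F t (z t)) t) →
        (∀ t, 0 ≤ t → ‖z t - p t‖ < ε) ∧
        Tendsto (fun t => ‖z t - p t‖) atTop (𝓝 0)) := by
  have hFper' : ∀ t, F (t + T) = F t := fun t => funext (hFper t)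
  have hpc : Continuous p := continuous_iff_continuousAt.2 fun t => (hp t).continuousAt
  have hjac : ∀ t (v : Fin n → ℝ),
      (jacobianMatrix n (fun x => F t x) (p t)).mulVec v = PSD F (t, p t) v := by
    intro t v
    have hfd : fderiv ℝ (fun x => F t x) (p t) = PSD F (t, p t) := (PSD_deriv F hF t (p t)).fderiv
    have : jacobianMatrix n (fun x => F t x) (p t)
        = LinearMap.toMatrix' (PSD F (t, p t) : (Fin n → ℝ) →ₗ[ℝ] (Fin n → ℝ)) := by
      ext i j
      simp [jacobianMatrix, LinearMap.toMatrix'_apply, hfd]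
    rw [this, LinearMap.toMatrix'_mulVec]
    rfl
  have hU : ∀ v t, HasDerivAt (fun s => (Φ s).mulVec v) (PSD F (t, p t) ((Φ t).mulVec v)) t := by
    intro v t
    rw [← hjac, Matrix.mulVec_mulVec]
    rw [hasDerivAt_pi]
    intro i
    simp only [Matrix.mulVec, dotProduct]
    exact HasDerivAt.fun_sum fun j _ => (hΦ t i j).mul_const (v j)
  have hDper : ∀ t, PSD F (t + T, p (t + T)) = PSD F (t, p t) := by
    intro t
    have h1 := PSD_deriv F hF (t + T) (p (t + T))
    rw [hFper', hpper] at h1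
    rw [hpper]
    exact h1.unique (PSD_deriv F hF t (p t))
  have hadd : ∀ t, 0 ≤ t → ∀ v, (Φ (t + T)).mulVec v = (Φ t).mulVec ((Φ T).mulVec v) := by
    intro t ht v
    obtain ⟨K, hK⟩ := isCompact_Icc.exists_bound_of_continuousOn (s := Icc 0 t)
      (f := fun s => PSD F (s, p s))
      ((PSD_cont F hF).comp (f := fun s => (s, p s)) (by fun_prop)).continuousOn
    have hs : ∀ s, HasDerivAt (fun s => (Φ (s + T)).mulVec v - (Φ s).mulVec ((Φ T).mulVec v))
        (PSD F (s, p s) ((Φ (s + T)).mulVec v - (Φ s).mulVec ((Φ T).mulVec v))) s := by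
      intro s
      rw [map_sub]
      have h1 := (hU v (s + T)).comp_add_const s T
      rw [hDper] at h1
      exact h1.sub (hU _ s)
    have := eq_zero_of_abs_deriv_le_mul_abs_self_of_eq_zero_right (K := K) (a := 0) (b := t)
      (fun s _ => (hs s).continuousAt.continuousWithinAt)
      (fun s _ => (hs s).hasDerivWithinAt) (by simp [hΦ0])
      (fun s hs' => (ContinuousLinearMap.le_opNorm _ _).trans
        (mul_le_mul_of_nonneg_right (hK s ⟨hs'.1, hs'.2.le⟩) (norm_nonneg _))) t ⟨ht, le_rfl⟩
    exact sub_eq_zero.1 this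
  have hpow : ∀ (m : ℕ) v, (Φ (m * T)).mulVec v = (Φ T ^ m).mulVec v := by
    intro m
    induction m with
    | zero => intro v; simp [hΦ0]
    | succ m ih =>
      intro v
      have e : ((m + 1 : ℕ) : ℝ) * T = m * T + T := by push_cast; ring
      rw [e, hadd _ (by positivity), ih, Matrix.mulVec_mulVec, pow_succ]
  obtain ⟨m, hm1, hm⟩ := PS_gelfand n hn (Φ T) hmult
  have hperk : ∀ (k : ℕ) t, F (t + k * T) = F t ∧ p (t + k * T) = p t := by
    intro k
    induction k with
    | zero => simp
    | succ k ih =>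
      intro t
      have : t + ((k + 1 : ℕ) : ℝ) * T = (t + k * T) + T := by push_cast; ring
      rw [this, hFper', hpper]
      exact ih t
  exact PS_key n (m * T) (by positivity) F hF (fun t => (hperk m t).1) p hp
    (fun t => (hperk m t).2) (fun t v => (Φ t).mulVec v) (by simp [hΦ0]) hU
    (fun v => by rw [hpow]; exact hm v)
end

section
/- (Hopf bifurcation in the plane.) Let k ≥ 3 and consider the planar system x₁' = β(α)x₁ − γ(α)x₂ + p(x₁, x₂, α), x₂' = γ(α)x₁ + β(α)x₂ + q(x₁, x₂, α), where β, γ, p, q are of class C^{k+1}, p and q together with their first derivatives in (x₁,x₂) vanish at (x₁,x₂) = (0,0) for every α (so p, q = O(‖x‖²)), and β(0) = 0, β'(0) > 0, γ(0) > 0. Then there exist h > 0, α₀ > 0, δ ∈ (0, h), and a function α : [0, δ) → ℝ of class C^{k−1} with α(0) = 0 and α'(0) = 0, such that σ := sup{|α(c)| : c ∈ [0, δ)} < α₀, and for parameter values α ∈ (−σ, σ) the orbit of the system through the point (c, 0) with c ∈ (0, δ) is a closed periodic orbit if and only if α = α(c). -/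
open Set Filter Topology
namespace Hopf

/-- Pointwise application of a continuous family of operators, as a bilinear map. -/
noncomputable def ptApply (K E F : Type) [TopologicalSpace K] [CompactSpace K]
    [NormedAddCommGroup E] [NormedSpace ℝ E] [NormedAddCommGroup F] [NormedSpace ℝ F] :
    C(K, E →L[ℝ] F) →L[ℝ] C(K, E) →L[ℝ] C(K, F) :=
  LinearMap.mkContinuous₂
    (LinearMap.mk₂ ℝ (fun (A : C(K, E →L[ℝ] F)) (h : C(K, E)) =>
        (⟨fun k => A k (h k), by fun_prop⟩ : C(K, F)))
      (by intros; ext; simp) (by intros; ext; simp) (by intros; ext; simp) (by intros; ext; simp))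
    1 (by
      intro A h
      rw [ContinuousMap.norm_le _ (by positivity)]
      intro k
      simp only [LinearMap.mk₂_apply, ContinuousMap.coe_mk, one_mul]
      exact (A k).le_of_opNorm_le_of_le (A.norm_coe_le_norm k) (h.norm_coe_le_norm k))

/-- Post-composition. -/
def post {K E F : Type} [TopologicalSpace K] [TopologicalSpace E] [TopologicalSpace F]
    (g : E → F) (hg : Continuous g) (u : C(K, E)) : C(K, F) := ⟨fun k => g (u k), by fun_prop⟩

lemma continuous_post {K E F : Type} [TopologicalSpace K] [TopologicalSpace E] [TopologicalSpace F]
    (g : E → F) (hg : Continuous g) : Continuous (post (K := K) g hg) :=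
  ContinuousMap.continuous_postcomp (⟨g, hg⟩ : C(E, F))

lemma hasFDerivAt_post {K E F : Type} [TopologicalSpace K] [CompactSpace K]
    [NormedAddCommGroup E] [NormedSpace ℝ E] [NormedAddCommGroup F] [NormedSpace ℝ F]
    (g : E → F) (hg : Continuous g) (g' : E → E →L[ℝ] F) (hg' : Continuous g')
    (hd : ∀ x, HasFDerivAt g (g' x) x) (u : C(K, E)) :
    HasFDerivAt (post g hg) (ptApply K E F (post g' hg' u)) u := by
  rw [hasFDerivAt_iff_isLittleO_nhds_zero, Asymptotics.isLittleO_iff]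
  intro ε hε
  obtain ⟨δ, hδ, H⟩ := (Metric.continuousAt_iff (α := C(K, E)) (β := C(K, E →L[ℝ] F))).1
    ((continuous_post (K := K) g' hg').continuousAt (x := u)) ε hε
  filter_upwards [Metric.ball_mem_nhds (0 : C(K, E)) hδ] with h hh
  rw [ContinuousMap.norm_le _ (by positivity)]
  intro k
  have hk : ‖h k‖ < δ := lt_of_le_of_lt (h.norm_coe_le_norm k) (by simpa using hh)
  have key : ‖g (u k + h k) - g (u k) - g' (u k) (u k + h k - u k)‖
      ≤ ε * ‖u k + h k - u k‖ := by
    refine Convex.norm_image_sub_le_of_norm_hasFDerivWithin_le' (s := Metric.ball (u k) δ)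
      (f' := g') (fun y _ => (hd y).hasFDerivWithinAt) ?_ (convex_ball _ _)
      (Metric.mem_ball_self hδ) (by simpa using hk)
    intro y hy
    have h1 := H (x := u + ContinuousMap.const K (y - u k)) (by
      rw [dist_eq_norm]
      simp only [add_sub_cancel_left]
      refine lt_of_le_of_lt ((ContinuousMap.norm_le _ (norm_nonneg (y - u k))).2 ?_)
        (by simpa [dist_eq_norm] using hy)
      intro x; simp)
    have h2 := (ContinuousMap.dist_apply_le_dist (f := post g' hg'
      (u + ContinuousMap.const K (y - u k))) (g := post g' hg' u) k).trans h1.le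
    simpa [post, dist_eq_norm] using h2
  rw [add_sub_cancel_left] at key
  refine le_trans ?_ (key.trans (by gcongr; exact h.norm_coe_le_norm k))
  apply le_of_eq
  simp [post, ptApply]

lemma contDiff_post {K E : Type} [TopologicalSpace K] [CompactSpace K]
    [NormedAddCommGroup E] [NormedSpace ℝ E] (n : ℕ) :
    ∀ {F : Type} [NormedAddCommGroup F] [NormedSpace ℝ F]
    (g : E → F) (hg : Continuous g) (_ : ContDiff ℝ n g),
    ContDiff ℝ n (post (K := K) g hg) := by
  induction n with
  | zero =>
    intro F _ _ g hg _
    simpa using continuous_post g hg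
  | succ n ih =>
    intro F _ _ g hg h
    have h' := h
    push_cast at h' ⊢
    rw [contDiff_succ_iff_fderiv] at h'
    have hc : Continuous (fderiv ℝ g) := h'.2.2.continuous
    have hd := hasFDerivAt_post (K := K) g hg (fderiv ℝ g) hc
      (fun x => (h'.1 x).hasFDerivAt)
    rw [contDiff_succ_iff_fderiv]
    refine ⟨fun u => (hd u).differentiableAt, by simp, ?_⟩
    have : fderiv ℝ (post (K := K) g hg) = fun u => ptApply K E F (post (fderiv ℝ g) hc u) :=
      funext fun u => (hd u).fderiv
    rw [this]
    exact (ptApply K E F).contDiff.comp (ih _ hc h'.2.2)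

abbrev I := Icc (0:ℝ) 1

noncomputable def ext0 {F : Type} [TopologicalSpace F] (u : C(I, F)) (t : ℝ) : F :=
  u (projIcc 0 1 zero_le_one t)

lemma continuous_ext0 {F : Type} [TopologicalSpace F] (u : C(I, F)) : Continuous (ext0 u) :=
  u.continuous.comp continuous_projIcc

lemma ext0_coe {F : Type} [TopologicalSpace F] (u : C(I, F)) (t : I) : ext0 u t = u t := by
  simp [ext0]

/-- Integration from `0`. -/
noncomputable def J (F : Type) [NormedAddCommGroup F] [NormedSpace ℝ F] :
    C(I, F) →L[ℝ] C(I, F) :=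
  LinearMap.mkContinuous
    { toFun := fun u => ⟨fun t => ∫ r in (0:ℝ)..t, ext0 u r,
        (intervalIntegral.continuous_primitive
          (fun a b => (continuous_ext0 u).intervalIntegrable a b) 0).comp continuous_subtype_val⟩
      map_add' := by
        intro u v; ext t
        simp only [ContinuousMap.coe_mk, ContinuousMap.add_apply]
        rw [← intervalIntegral.integral_add ((continuous_ext0 u).intervalIntegrable _ _)
          ((continuous_ext0 v).intervalIntegrable _ _)]
        rfl
      map_smul' := by
        intro c u; ext t
        simp only [ContinuousMap.coe_mk, ContinuousMap.smul_apply, RingHom.id_apply]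
        rw [← intervalIntegral.integral_smul]
        rfl }
    1 (by
      intro u
      rw [ContinuousMap.norm_le _ (by positivity)]
      intro t
      simp only [LinearMap.coe_mk, AddHom.coe_mk, ContinuousMap.coe_mk, one_mul]
      refine (intervalIntegral.norm_integral_le_of_norm_le_const (C := ‖u‖)
        (fun x _ => u.norm_coe_le_norm _)).trans ?_
      rw [sub_zero, abs_of_nonneg t.2.1]
      exact mul_le_of_le_one_right (norm_nonneg _) t.2.2)

lemma J_apply {F : Type} [NormedAddCommGroup F] [NormedSpace ℝ F] (u : C(I, F)) (t : I) :
    J F u t = ∫ r in (0:ℝ)..t, ext0 u r := rfl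

/-- smoothness of parametric integrals -/
lemma contDiff_integral {E F : Type} [NormedAddCommGroup E] [NormedSpace ℝ E]
    [NormedAddCommGroup F] [NormedSpace ℝ F] (n : ℕ) (g : ℝ × E → F) (hg : ContDiff ℝ n g) :
    ContDiff ℝ n (fun e => ∫ s in (0:ℝ)..1, g (s, e)) := by
  let A : E → C(I, ℝ × E) := fun e => ⟨fun t => ((t : ℝ), (0 : E)), by fun_prop⟩ +
    (ContinuousLinearMap.inr ℝ ℝ E).compLeftContinuous ℝ I (ContinuousMap.const I e)
  have hA : ContDiff ℝ n A := by
    refine contDiff_const.add ((ContinuousLinearMap.contDiff _).comp ?_)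
    exact (ContinuousLinearMap.contDiff (ContinuousLinearMap.const ℝ I : E →L[ℝ] C(I, E)))
  have h1 : ContDiff ℝ n (fun e => (ContinuousMap.evalCLM ℝ (1 : I)) (J F (post g hg.continuous (A e)))) :=
    (ContinuousLinearMap.contDiff _).comp ((ContinuousLinearMap.contDiff _).comp
      ((contDiff_post n g hg.continuous hg).comp hA))
  convert h1 using 2 with e
  simp only [ContinuousMap.evalCLM_apply, J_apply]
  apply intervalIntegral.integral_congr
  intro s hs
  rw [uIcc_of_le zero_le_one] at hs
  simp [ext0, post, A, projIcc_of_mem _ hs]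

end Hopf

namespace Hopf

/-- The linear map `(c, α, w) ↦ (s ↦ (c, w s, α))`. -/
noncomputable def Bmap : ((ℝ × ℝ) × C(I, ℂ)) →L[ℝ] C(I, ℝ × ℂ × ℝ) :=
  LinearMap.mkContinuous
    { toFun := fun v => ⟨fun s => (v.1.1, v.2 s, v.1.2), by fun_prop⟩
      map_add' := by intro u v; ext <;> simp
      map_smul' := by intro c v; ext <;> simp }
    1 (by
      intro v
      rw [ContinuousMap.norm_le _ (by positivity)]
      intro s
      simp only [LinearMap.coe_mk, AddHom.coe_mk, ContinuousMap.coe_mk, one_mul]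
      refine max_le ((norm_fst_le v.1).trans (norm_fst_le v)) (max_le ?_ ?_)
      · exact (v.2.norm_coe_le_norm s).trans (norm_snd_le v)
      · exact (norm_snd_le v.1).trans (norm_fst_le v))

lemma Bmap_apply (c α : ℝ) (w : C(I, ℂ)) (s : I) : Bmap ((c, α), w) s = (c, w s, α) := rfl

lemma flow (k : ℕ) (hk : 1 ≤ k) (H : ℝ × ℂ × ℝ → ℂ) (hH : ContDiff ℝ k H) (κ : ℝ → ℂ)
    (hH0 : ∀ w α, H (0, w, α) = κ α) (T0 : ℝ) :
    ∃ w : ℝ × ℝ × ℝ → C(I, ℂ), ContDiffAt ℝ k w (0, 0, T0) ∧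
      (∀ s : I, w (0, 0, T0) s = s * T0 * κ 0) ∧
      ∀ᶠ v in 𝓝 ((0, 0, T0) : ℝ × ℝ × ℝ),
        w v = v.2.2 • J ℂ (post H hH.continuous (Bmap ((v.1, v.2.1), w v))) := by
  have hk0 : ((k : ℕ) : WithTop ℕ∞) ≠ 0 := by
    simp; omega
  let Φ : (ℝ × ℝ × ℝ) × C(I, ℂ) → C(I, ℂ) := fun p =>
    p.2 - p.1.2.2 • J ℂ (post H hH.continuous (Bmap ((p.1.1, p.1.2.1), p.2)))
  let w0 : C(I, ℂ) := ⟨fun s => (s : ℝ) * T0 * κ 0, by fun_prop⟩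
  have hΦ : ContDiff ℝ k Φ := by
    have e1 : ContDiff ℝ k (fun p : (ℝ × ℝ × ℝ) × C(I, ℂ) => p.1.2.2) := by fun_prop
    have e2 : ContDiff ℝ k (fun p : (ℝ × ℝ × ℝ) × C(I, ℂ) => ((p.1.1, p.1.2.1), p.2)) := by
      fun_prop
    exact contDiff_snd.sub (e1.smul ((ContinuousLinearMap.contDiff _).comp
      ((contDiff_post k H hH.continuous hH).comp ((ContinuousLinearMap.contDiff _).comp e2))))
  have hconst : ∀ w : C(I, ℂ), post H hH.continuous (Bmap ((0, 0), w))
      = ContinuousMap.const I (κ 0) := by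
    intro w; ext1 s
    exact hH0 _ _
  have hΦ0 : ∀ w, Φ ((0, 0, T0), w) = w - w0 := by
    intro w
    simp only [Φ, hconst]
    congr 1
    ext1 s
    simp [J_apply, ext0, w0]
    ring
  have hu : ContDiffAt ℝ k Φ ((0, 0, T0), w0) := hΦ.contDiffAt
  have hder : fderiv ℝ Φ ((0, 0, T0), w0) ∘L .inr ℝ (ℝ × ℝ × ℝ) C(I, ℂ) =
      ContinuousLinearMap.id ℝ _ := by
    have h1 : HasFDerivAt (fun w : C(I, ℂ) => Φ ((0, 0, T0), w))
        (fderiv ℝ Φ ((0, 0, T0), w0) ∘L .inr ℝ (ℝ × ℝ × ℝ) C(I, ℂ)) w0 :=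
      ((hu.differentiableAt hk0).hasFDerivAt).comp w0 (hasFDerivAt_prodMk_right _ _)
    have h2 : HasFDerivAt (fun w : C(I, ℂ) => Φ ((0, 0, T0), w))
        (ContinuousLinearMap.id ℝ _) w0 := by
      simp only [hΦ0]
      exact (hasFDerivAt_id _).sub_const _
    exact h1.unique h2
  have hinv : (fderiv ℝ Φ ((0, 0, T0), w0) ∘L .inr ℝ (ℝ × ℝ × ℝ) C(I, ℂ)).IsInvertible := by
    rw [hder]; exact ⟨ContinuousLinearEquiv.refl ℝ _, rfl⟩
  refine ⟨hu.implicitFunction hk0 hinv, hu.contDiffAt_implicitFunction hk0 hinv, ?_, ?_⟩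
  · intro s
    have := hu.implicitFunction_apply_self hk0 hinv
    simp only at this
    rw [this]; rfl
  · filter_upwards [hu.eventually_apply_implicitFunction hk0 hinv] with v hv
    rw [hΦ0, sub_self] at hv
    exact sub_eq_zero.1 hv

lemma antiper_integral (g : ℝ → ℂ) (hg : Continuous g) (h : ∀ s, g (s + 1 / 2) = - g s) :
    ∫ s in (0:ℝ)..1, g s = 0 := by
  rw [← intervalIntegral.integral_add_adjacent_intervals (b := 1 / 2)
    (hg.intervalIntegrable _ _) (hg.intervalIntegrable _ _)]
  have : ∫ s in (1 / 2 : ℝ)..1, g s = ∫ s in (0:ℝ)..(1 / 2), g (s + 1 / 2) := by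
    rw [intervalIntegral.integral_comp_add_right]
    norm_num
  rw [this]
  simp only [h]
  simp

lemma flow_deriv (k : ℕ) (hk : 1 ≤ k) (H : ℝ × ℂ × ℝ → ℂ) (hH : ContDiff ℝ k H) (κ : ℝ → ℂ)
    (hH0 : ∀ w α, H (0, w, α) = κ α) (T0 : ℝ) (κ' : ℂ) (hκ : HasDerivAt κ κ' 0)
    (hsym : ∀ c w α, H (-c, w, α) = H (c, w + Real.pi * Complex.I, α))
    (ε : ℝ) (hε : ε = 1 ∨ ε = -1) (hT0 : T0 * κ 0 = 2 * Real.pi * ε * Complex.I)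
    (w : ℝ × ℝ × ℝ → C(I, ℂ)) (hw : ContDiffAt ℝ k w (0, 0, T0))
    (hw0 : ∀ s : I, w (0, 0, T0) s = s * T0 * κ 0)
    (hwe : ∀ᶠ v in 𝓝 ((0, 0, T0) : ℝ × ℝ × ℝ),
        w v = v.2.2 • J ℂ (post H hH.continuous (Bmap ((v.1, v.2.1), w v)))) :
    ContDiffAt ℝ k (fun v => w v 1) (0, 0, T0) ∧
    ∃ L : ℝ × ℝ × ℝ →L[ℝ] ℂ, HasFDerivAt (fun v => w v 1) L (0, 0, T0) ∧
      ∀ a b t, L (a, b, t) = b * (T0 * κ') + t * κ 0 := by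
  have hk0 : ((k : ℕ) : WithTop ℕ∞) ≠ 0 := by
    simp; omega
  have hW : ContDiffAt ℝ k (fun v => w v 1) (0, 0, T0) :=
    (ContinuousMap.evalCLM ℝ (1 : I) : C(I, ℂ) →L[ℝ] ℂ).contDiff.contDiffAt.comp _ hw
  obtain ⟨L, hL⟩ := hW.differentiableAt hk0
  refine ⟨hW, L, hL, ?_⟩
  -- direction α and T
  have hαT : ∀ᶠ v in 𝓝 ((0, T0) : ℝ × ℝ), w (0, v) 1 = v.2 * κ v.1 := by
    have hc : Tendsto (fun v : ℝ × ℝ => ((0 : ℝ), v)) (𝓝 (0, T0)) (𝓝 (0, 0, T0)) :=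
      (by fun_prop : Continuous (fun v : ℝ × ℝ => ((0 : ℝ), v))).tendsto _
    filter_upwards [hc.eventually hwe] with v hv
    rw [hv]
    have : post H hH.continuous (Bmap ((0, v.1), w (0, v))) = ContinuousMap.const I (κ v.1) := by
      ext1 s; exact hH0 _ _
    simp only [this]
    simp [J_apply, ext0]
  have hLαT : ∀ b t, L (0, b, t) = b * (T0 * κ') + t * κ 0 := by
    have h1 : HasFDerivAt (fun v : ℝ × ℝ => w (0, v) 1) (L ∘L .inr ℝ ℝ (ℝ × ℝ)) (0, T0) :=
      hL.comp _ (hasFDerivAt_prodMk_right _ _)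
    have h2 : HasFDerivAt (fun v : ℝ × ℝ => v.2 • κ v.1) _ ((0, T0) : ℝ × ℝ) :=
      (hasFDerivAt_snd (𝕜 := ℝ) (p := ((0, T0) : ℝ × ℝ))).smul
        (HasFDerivAt.comp (g := κ) ((0, T0) : ℝ × ℝ) hκ.hasFDerivAt hasFDerivAt_fst)
    have h3 := h1.unique (h2.congr_of_eventuallyEq (by
      filter_upwards [hαT] with v hv
      rw [hv]; simp))
    intro b t
    have := congrArg (fun M : ℝ × ℝ →L[ℝ] ℂ => M (b, t)) h3
    simp at this
    rw [this]
    ring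
  -- direction c
  have hLc : L (1, 0, 0) = 0 := by
    let ι : ℝ → ℝ × ℝ × ℝ := fun c => (c, 0, T0)
    have hι : HasDerivAt ι (1, 0, 0) 0 :=
      (hasDerivAt_id _).prodMk (hasDerivAt_const _ _)
    obtain ⟨Lw, hLw⟩ := hw.differentiableAt hk0
    have hwι : HasDerivAt (fun c => w (ι c)) (Lw (1, 0, 0)) 0 :=
      HasFDerivAt.comp_hasDerivAt (0 : ℝ) (f := ι) hLw hι
    have hB : HasDerivAt (fun c => Bmap ((c, 0), w (ι c))) (Bmap ((1, 0), Lw (1, 0, 0))) 0 :=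
      Bmap.hasFDerivAt.comp_hasDerivAt (0 : ℝ)
        (((hasDerivAt_id _).prodMk (hasDerivAt_const _ _)).prodMk hwι)
    have hpost : DifferentiableAt ℝ (post (K := I) H hH.continuous) (Bmap ((0, 0), w (ι 0))) :=
      (contDiff_post k H hH.continuous hH).contDiffAt.differentiableAt hk0
    obtain ⟨Lp, hLp⟩ := hpost
    have hN : HasDerivAt (fun c => post H hH.continuous (Bmap ((c, 0), w (ι c))))
        (Lp (Bmap ((1, 0), Lw (1, 0, 0)))) 0 :=
      HasFDerivAt.comp_hasDerivAt (0 : ℝ) (f := fun c => Bmap ((c, 0), w (ι c)))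
        (l := post H hH.continuous) hLp hB
    set N' := Lp (Bmap ((1, 0), Lw (1, 0, 0))) with hN'
    let Q : ℂ → ℂ := fun z => fderiv ℝ H (0, z, 0) (1, 0, 0)
    have hHd : ∀ y, HasFDerivAt H (fderiv ℝ H y) y := fun y =>
      (hH.contDiffAt.differentiableAt hk0).hasFDerivAt
    have hQ : Continuous Q := by
      have := hH.continuous_fderiv hk0
      fun_prop
    have hQd : ∀ z, HasDerivAt (fun c : ℝ => H (c, z, 0)) (Q z) 0 := by
      intro z
      exact HasFDerivAt.comp_hasDerivAt (0 : ℝ) (f := fun c : ℝ => (c, z, (0 : ℝ))) (hHd _)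
        ((hasDerivAt_id _).prodMk (hasDerivAt_const _ _))
    have hQanti : ∀ z, Q (z + Real.pi * Complex.I) = - Q z := by
      intro z
      have h1 := hQd (z + Real.pi * Complex.I)
      simp only [← hsym] at h1
      have h2 : HasDerivAt (fun c : ℝ => H (-c, z, 0)) (-Q z) 0 := by
        have := HasDerivAt.scomp (0 : ℝ) (h := fun c : ℝ => -c) (h' := -1)
          (g₁ := fun c : ℝ => H (c, z, 0)) (g₁' := Q z)
          (by simpa using hQd z) (hasDerivAt_neg _)
        simpa [Function.comp_def] using this
      exact h1.unique h2
    have hHw : ∀ z y : ℂ, fderiv ℝ H (0, z, 0) (0, y, 0) = 0 := by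
      intro z y
      have h1 : HasDerivAt (fun t : ℝ => H (0, z + t • y, 0)) (fderiv ℝ H (0, z, 0) (0, y, 0)) 0 := by
        refine HasFDerivAt.comp_hasDerivAt (0 : ℝ) (f := fun t : ℝ => ((0:ℝ), z + t • y, (0 : ℝ)))
          (l := H) (by simpa using hHd (0, z, 0)) ?_
        refine (hasDerivAt_const _ _).prodMk (HasDerivAt.prodMk ?_ (hasDerivAt_const _ _))
        simpa using ((hasDerivAt_id (0:ℝ)).smul_const y).const_add z
      simp only [hH0] at h1
      exact h1.unique (hasDerivAt_const _ _)
    have hN's : ∀ s : I, N' s = Q (w (ι 0) s) := by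
      intro s
      have h1 : HasDerivAt (fun c => H (c, w (ι c) s, 0)) (N' s) 0 :=
        (ContinuousMap.evalCLM ℝ s : C(I, ℂ) →L[ℝ] ℂ).hasFDerivAt.comp_hasDerivAt (0 : ℝ) hN
      have h2 : HasDerivAt (fun c => H (c, w (ι c) s, 0))
          (fderiv ℝ H (0, w (ι 0) s, 0) (1, Lw (1, 0, 0) s, 0)) 0 := by
        refine HasFDerivAt.comp_hasDerivAt (0 : ℝ) (f := fun c => (c, w (ι c) s, (0:ℝ)))
          (l := H) (hHd _) ?_
        refine (hasDerivAt_id _).prodMk (HasDerivAt.prodMk ?_ (hasDerivAt_const _ _))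
        exact (ContinuousMap.evalCLM ℝ s : C(I, ℂ) →L[ℝ] ℂ).hasFDerivAt.comp_hasDerivAt (0 : ℝ) hwι
      rw [h1.unique h2]
      have : ((1 : ℝ), Lw (1, 0, 0) s, (0 : ℝ)) = (1, 0, 0) + (0, Lw (1, 0, 0) s, 0) := by simp
      rw [this, map_add, hHw, add_zero]
    have hint : J ℂ N' 1 = 0 := by
      rw [J_apply]
      have : ∫ r in (0:ℝ)..((1 : I) : ℝ), ext0 N' r
          = ∫ r in (0:ℝ)..1, Q (r * (2 * Real.pi * ε * Complex.I)) := by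
        apply intervalIntegral.integral_congr
        intro s hs
        simp only [Icc.coe_one, uIcc_of_le zero_le_one] at hs
        simp only [ext0, projIcc_of_mem _ hs, hN's]
        congr 1
        rw [← hT0, ← mul_assoc]
        exact hw0 _
      rw [this]
      refine antiper_integral _ (by fun_prop) ?_
      intro s
      rcases hε with rfl | rfl
      · rw [← hQanti]; congr 1; push_cast; ring
      · rw [eq_neg_iff_add_eq_zero, ← neg_eq_iff_add_eq_zero, ← hQanti]; congr 1; push_cast; ring
    have hfin : HasDerivAt (fun c => T0 • J ℂ (post H hH.continuous (Bmap ((c, 0), w (ι c)))) 1)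
        (T0 • J ℂ N' 1) 0 :=
      (((ContinuousMap.evalCLM ℝ (1 : I) : C(I, ℂ) →L[ℝ] ℂ).comp
        (J ℂ)).hasFDerivAt.comp_hasDerivAt (0 : ℝ) hN).const_smul T0
    rw [hint, smul_zero] at hfin
    have h5 : HasDerivAt (fun c => w (ι c) 1) (L (1, 0, 0)) 0 :=
      HasFDerivAt.comp_hasDerivAt (0 : ℝ) (f := ι) hL hι
    refine h5.unique (hfin.congr_of_eventuallyEq ?_)
    have hc : Tendsto ι (𝓝 0) (𝓝 (0, 0, T0)) := hι.continuousAt.tendsto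
    filter_upwards [hc.eventually hwe] with c hv
    conv_lhs => rw [hv]
    rfl
  intro a b t
  have : ((a, b, t) : ℝ × ℝ × ℝ) = a • ((1, 0, 0) : ℝ × ℝ × ℝ) + (0, b, t) := by simp
  rw [this, map_add, map_smul, hLc, hLαT]
  simp

end Hopf

namespace Hopf

lemma ift_scalar {E : Type} [NormedAddCommGroup E] [NormedSpace ℝ E] [CompleteSpace E]
    (k : ℕ) (hk : 1 ≤ k) (f : E × ℝ → ℝ) (x0 : E) (y0 : ℝ) (hf : ContDiffAt ℝ k f (x0, y0))
    (L : E × ℝ →L[ℝ] ℝ) (hL : HasFDerivAt f L (x0, y0)) (h1 : L (0, 1) ≠ 0) :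
    ∃ φ : E → ℝ, ContDiffAt ℝ k φ x0 ∧ φ x0 = y0 ∧
      (∀ᶠ x in 𝓝 x0, f (x, φ x) = f (x0, y0)) ∧
      (∀ᶠ v in 𝓝 (x0, y0), f v = f (x0, y0) ↔ φ v.1 = v.2) ∧
      ∃ M : E →L[ℝ] ℝ, HasFDerivAt φ M x0 ∧ ∀ e, L (e, M e) = 0 := by
  have hk0 : ((k : ℕ) : WithTop ℕ∞) ≠ 0 := by
    simp; omega
  have hinv : (fderiv ℝ f (x0, y0) ∘L .inr ℝ E ℝ).IsInvertible := by
    rw [hL.fderiv]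
    refine ⟨ContinuousLinearEquiv.unitsEquivAut ℝ (Units.mk0 _ h1), ?_⟩
    ext
    simp
  have hd := hf.hasStrictFDerivAt_implicitFunction hk0 hinv
  have e0 := hf.implicitFunction_apply_self hk0 hinv
  have e1 := hf.eventually_apply_implicitFunction hk0 hinv
  refine ⟨hf.implicitFunction hk0 hinv, hf.contDiffAt_implicitFunction hk0 hinv,
    e0, e1, hf.eventually_apply_eq_iff_implicitFunction hk0 hinv,
    _, hd.hasFDerivAt, ?_⟩
  set φ := hf.implicitFunction hk0 hinv
  set M := -(fderiv ℝ f (x0, y0) ∘L .inr ℝ E ℝ).inverse ∘L (fderiv ℝ f (x0, y0) ∘L .inl ℝ E ℝ)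
  intro e
  have h2 : HasFDerivAt (fun x => f (x, φ x)) (L ∘L ((ContinuousLinearMap.id ℝ E).prod M)) x0 := by
    refine HasFDerivAt.comp (f := fun x => (x, φ x)) (g := f) x0 ?_
      ((hasFDerivAt_id _).prodMk hd.hasFDerivAt)
    rw [show φ x0 = y0 from e0]; exact hL
  have h3 := h2.unique ((hasFDerivAt_const (f (x0, y0)) x0).congr_of_eventuallyEq e1)
  have := congrArg (fun N : E →L[ℝ] ℝ => N e) h3
  simpa using this

lemma ret (k : ℕ) (hk : 1 ≤ k) (H : ℝ × ℂ × ℝ → ℂ) (hH : ContDiff ℝ k H) (κ : ℝ → ℂ)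
    (hH0 : ∀ w α, H (0, w, α) = κ α) (κ' : ℂ) (hκ : HasDerivAt κ κ' 0)
    (hsym : ∀ c w α, H (-c, w, α) = H (c, w + Real.pi * Complex.I, α))
    (γ0 : ℝ) (hγ0 : 0 < γ0) (hκ0 : κ 0 = γ0 * Complex.I)
    (ε : ℝ) (hε : ε = 1 ∨ ε = -1) :
    ∃ (U τ : ℝ × ℝ → ℝ) (ω : ℝ × ℝ → ℝ → ℂ), ContDiffAt ℝ k U (0, 0) ∧ U (0, 0) = 0 ∧
      (∃ L : ℝ × ℝ →L[ℝ] ℝ, HasFDerivAt U L (0, 0) ∧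
        ∀ a b, L (a, b) = b * (2 * Real.pi * ε / γ0 * κ'.re)) ∧
      ∀ᶠ v in 𝓝 ((0, 0) : ℝ × ℝ), Real.pi / γ0 < ε * τ v ∧ ω v 0 = 0 ∧
        ω v 1 = U v + 2 * Real.pi * ε * Complex.I ∧
        (∀ t ∈ Icc (0:ℝ) 1, HasDerivAt (ω v) (τ v * H (v.1, ω v t, v.2)) t) ∧
        ∀ t ∈ Ioo (0:ℝ) 1, 0 < ε * (ω v t).im ∧ ε * (ω v t).im < 2 * Real.pi := by
  have hpi := Real.pi_pos
  have hε2 : ε * ε = 1 := by rcases hε with rfl | rfl <;> norm_num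
  set T0 : ℝ := 2 * Real.pi * ε / γ0 with hT0
  have hT0κ : T0 * κ 0 = 2 * Real.pi * ε * Complex.I := by
    rw [hκ0, hT0]
    push_cast
    have : (γ0 : ℂ) ≠ 0 := by exact_mod_cast hγ0.ne'
    field_simp
  obtain ⟨w, hw, hw0, hwe⟩ := flow k hk H hH κ hH0 T0
  obtain ⟨hW, L, hL, hLv⟩ := flow_deriv k hk H hH κ hH0 T0 κ' hκ hsym ε hε hT0κ w hw hw0 hwe
  have hk0 : ((k : ℕ) : WithTop ℕ∞) ≠ 0 := by
    simp; omega
  -- reassociate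
  let A : (ℝ × ℝ) × ℝ →L[ℝ] ℝ × ℝ × ℝ :=
    ((ContinuousLinearMap.fst ℝ ℝ ℝ).comp (ContinuousLinearMap.fst ℝ (ℝ × ℝ) ℝ)).prod
    (((ContinuousLinearMap.snd ℝ ℝ ℝ).comp (ContinuousLinearMap.fst ℝ (ℝ × ℝ) ℝ)).prod
      (ContinuousLinearMap.snd ℝ (ℝ × ℝ) ℝ))
  have hA : ∀ a b t, A ((a, b), t) = (a, b, t) := fun a b t => rfl
  have hWA : ContDiffAt ℝ k (fun v => w (A v) 1) ((0, 0), T0) :=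
    ContDiffAt.comp (g := fun v => w v 1) (f := A) ((0, 0), T0) hW A.contDiff.contDiffAt
  have hLA : HasFDerivAt (fun v => w (A v) 1) (L ∘L A) ((0, 0), T0) :=
    HasFDerivAt.comp (g := fun v => w v 1) (f := A) ((0, 0), T0) hL A.hasFDerivAt
  obtain ⟨τ, hτ, hτ0, hτe, -, M, hM, -⟩ := ift_scalar k hk (fun v => (w (A v) 1).im) (0, 0) T0
    (Complex.imCLM.contDiff.contDiffAt.comp _ hWA) (Complex.imCLM ∘L (L ∘L A))
    (Complex.imCLM.hasFDerivAt.comp _ hLA) (by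
      show (L (A ((0, 0), 1))).im ≠ 0
      rw [hA, hLv, hκ0]
      simp [hγ0.ne'])
  let V : ℝ × ℝ → ℝ × ℝ × ℝ := fun v => A (v, τ v)
  have hV0 : V (0, 0) = (0, 0, T0) := by simp only [V, hτ0]; rfl
  have hVc : ContDiffAt ℝ k V (0, 0) := A.contDiff.contDiffAt.comp _ (contDiffAt_id.prodMk hτ)
  have hVt : Tendsto V (𝓝 (0, 0)) (𝓝 (0, 0, T0)) := by
    have := hVc.continuousAt.tendsto; rwa [hV0] at this
  have hbase : w (0, 0, T0) 1 = 2 * Real.pi * ε * Complex.I := by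
    rw [hw0]; simp only [Icc.coe_one]; rw [← hT0κ]; simp
  let ω : ℝ × ℝ → ℝ → ℂ := fun v t =>
    τ v * ∫ r in (0:ℝ)..t, H (v.1, ext0 (w (V v)) r, v.2)
  refine ⟨fun v => (w (V v) 1).re, τ, ω, ?_, ?_, ?_, ?_⟩
  · refine Complex.reCLM.contDiff.contDiffAt.comp _ ?_
    refine ContDiffAt.comp (g := fun v => w v 1) (f := V) (0, 0) ?_ hVc
    rw [hV0]; exact hW
  · simp only [hV0, hbase]; simp
  · refine ⟨Complex.reCLM ∘L (L ∘L (A ∘L ((ContinuousLinearMap.id ℝ (ℝ × ℝ)).prod M))), ?_, ?_⟩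
    · refine Complex.reCLM.hasFDerivAt.comp _ ?_
      refine HasFDerivAt.comp (g := fun v => w v 1) (f := V) (0, 0) (by rw [hV0]; exact hL) ?_
      exact A.hasFDerivAt.comp _ ((hasFDerivAt_id _).prodMk hM)
    · intro a b
      show (L (A ((a, b), M (a, b)))).re = _
      rw [hA, hLv, hκ0]
      simp
  · have hcont : ContinuousAt (fun v : ℝ × ℝ =>
        post H hH.continuous (Bmap ((v.1, v.2), w (V v)))) (0, 0) := by
      have h1 : ContinuousAt (fun v => w (V v)) (0, 0) :=
        ContinuousAt.comp (g := w) (f := V) (by rw [hV0]; exact hw.continuousAt) hVc.continuousAt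
      exact (continuous_post H hH.continuous).continuousAt.comp
        (Bmap.continuous.continuousAt.comp ((continuousAt_id).prodMk h1))
    have hnear := (Metric.tendsto_nhds (α := C(I, ℂ))).1 hcont γ0 hγ0
    have hτnear : ∀ᶠ v in 𝓝 ((0, 0) : ℝ × ℝ), Real.pi / γ0 < ε * τ v := by
      refine (continuousAt_const.mul hτ.continuousAt).eventually_const_lt ?_
      show Real.pi / γ0 < ε * τ (0, 0)
      rw [hτ0, hT0]
      rw [show ε * (2 * Real.pi * ε / γ0) = 2 * Real.pi / γ0 * (ε * ε) by ring, hε2, mul_one]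
      gcongr; linarith
    filter_upwards [hVt.eventually hwe, hτe, hnear, hτnear] with v hv1 hv2 hv3 hv4
    have hcts : Continuous (fun r => H (v.1, ext0 (w (V v)) r, v.2)) := by
      have := hH.continuous
      have := continuous_ext0 (w (V v))
      fun_prop
    have hωd : ∀ t, HasDerivAt (ω v) (τ v * H (v.1, ext0 (w (V v)) t, v.2)) t := fun t =>
      (hcts.integral_hasStrictDerivAt 0 t).hasDerivAt.const_mul _
    have hωw : ∀ s : I, ω v s = w (V v) s := by
      intro s
      conv_rhs => rw [hv1]
      simp only [ContinuousMap.smul_apply, J_apply]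
      show _ = τ v • _
      rw [Complex.real_smul]
      rfl
    have hωe : ∀ t ∈ Icc (0:ℝ) 1, ext0 (w (V v)) t = ω v t := by
      intro t ht
      rw [show ω v t = w (V v) ⟨t, ht⟩ from hωw ⟨t, ht⟩]
      simp [ext0, projIcc_of_mem _ ht]
    have hω0 : ω v 0 = 0 := by simp [ω]
    have hω1 : ω v 1 = ((w (V v) 1).re : ℂ) + 2 * Real.pi * ε * Complex.I := by
      rw [show ω v 1 = w (V v) 1 from hωw 1]
      rw [show A ((0, 0), T0) = (0, 0, T0) from rfl, hbase] at hv2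
      apply Complex.ext
      · simp
      · rw [show A (v, τ v) = V v from rfl] at hv2
        rw [hv2]; simp
    refine ⟨hv4, hω0, hω1, fun t ht => ?_, ?_⟩
    · have := hωd t
      rwa [hωe t ht] at this
    · have hpos : ∀ r, 0 < (H (v.1, ext0 (w (V v)) r, v.2)).im := by
        intro r
        have h1 := (ContinuousMap.dist_apply_le_dist (projIcc (0:ℝ) 1 zero_le_one r)).trans_lt hv3
        have h2 : dist (H (v.1, ext0 (w (V v)) r, v.2)) (κ 0) < γ0 := by
          rw [← hH0 (w (V (0, 0)) (projIcc (0:ℝ) 1 zero_le_one r)) 0]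
          exact h1
        rw [dist_eq_norm] at h2
        have h3 := (Complex.abs_im_le_norm _).trans_lt h2
        rw [hκ0, abs_lt] at h3
        simp at h3
        linarith [h3.1]
      have hmono : StrictMono (fun t => ε * (ω v t).im) := by
        have hd : ∀ t, HasDerivAt (fun t => ε * (ω v t).im)
            (ε * (τ v * H (v.1, ext0 (w (V v)) t, v.2)).im) t := fun t =>
          (Complex.imCLM.hasFDerivAt.comp_hasDerivAt t (hωd t)).const_mul ε
        apply strictMono_of_deriv_pos
        intro t
        rw [(hd t).deriv, Complex.im_ofReal_mul, ← mul_assoc]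
        have : 0 < ε * τ v := lt_trans (by positivity) hv4
        exact mul_pos this (hpos t)
      intro t ht
      have a0 := hmono ht.1
      have a1 := hmono ht.2
      simp only [hω0, hω1] at a0 a1
      simp at a0 a1
      refine ⟨a0, a1.trans_eq ?_⟩
      linear_combination (2 * Real.pi) * hε2

end Hopf

namespace Hopf

/-- The Hadamard quotient `r(c e^w, α) / (c e^w)`. -/
noncomputable def Rm (r : ℂ × ℝ → ℂ) (v : ℝ × ℂ × ℝ) : ℂ :=
  Complex.exp (-v.2.1) * ∫ s in (0:ℝ)..1,
    fderiv ℝ r ((s * v.1 : ℝ) * Complex.exp v.2.1, v.2.2) (Complex.exp v.2.1, 0)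

lemma contDiff_Rm (k : ℕ) (r : ℂ × ℝ → ℂ) (hr : ContDiff ℝ (k + 1) r) : ContDiff ℝ k (Rm r) := by
  have hexp : ContDiff ℝ k Complex.exp := (Complex.contDiff_exp (𝕜 := ℂ)).restrict_scalars ℝ
  have hof : ContDiff ℝ k (fun x : ℝ => (x : ℂ)) := Complex.ofRealCLM.contDiff
  have hd : ContDiff ℝ k (fderiv ℝ r) := hr.fderiv_right le_rfl
  have e1 : ContDiff ℝ k (fun v : ℝ × ℂ × ℝ => Complex.exp v.2.1) := hexp.comp (by fun_prop)
  have e2 : ContDiff ℝ k (fun v : ℝ × ℂ × ℝ => Complex.exp (-v.2.1)) := hexp.comp (by fun_prop)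
  refine e2.mul (contDiff_integral k (fun p : ℝ × (ℝ × ℂ × ℝ) =>
    fderiv ℝ r ((p.1 * p.2.1 : ℝ) * Complex.exp p.2.2.1, p.2.2.2) (Complex.exp p.2.2.1, 0)) ?_)
  have e3 : ContDiff ℝ k (fun p : ℝ × (ℝ × ℂ × ℝ) => Complex.exp p.2.2.1) := hexp.comp (by fun_prop)
  have e4 : ContDiff ℝ k (fun p : ℝ × (ℝ × ℂ × ℝ) => ((p.1 * p.2.1 : ℝ) : ℂ)) :=
    hof.comp (by fun_prop)
  have e5 : ContDiff ℝ k (fun p : ℝ × (ℝ × ℂ × ℝ) =>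
    (((p.1 * p.2.1 : ℝ) : ℂ) * Complex.exp p.2.2.1, p.2.2.2)) := (e4.mul e3).prodMk (by fun_prop)
  exact (hd.comp e5).clm_apply (e3.prodMk contDiff_const)

lemma Rm_zero (r : ℂ × ℝ → ℂ) (h0 : ∀ α z, fderiv ℝ r (0, α) (z, 0) = 0) (w : ℂ) (α : ℝ) :
    Rm r (0, w, α) = 0 := by
  simp [Rm, h0]

lemma Rm_neg (r : ℂ × ℝ → ℂ) (c : ℝ) (w : ℂ) (α : ℝ) :
    Rm r (-c, w, α) = Rm r (c, w + Real.pi * Complex.I, α) := by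
  simp only [Rm]
  rw [Complex.exp_add, Complex.exp_pi_mul_I, neg_add, Complex.exp_add,
    Complex.exp_neg (Real.pi * Complex.I), Complex.exp_pi_mul_I]
  have : ∀ s : ℝ, fderiv ℝ r (((s * c : ℝ) : ℂ) * (Complex.exp w * -1), α) (Complex.exp w * -1, 0)
      = - fderiv ℝ r (((s * -c : ℝ) : ℂ) * Complex.exp w, α) (Complex.exp w, 0) := by
    intro s
    rw [← map_neg]
    congr 2 <;> simp
  simp only [this, intervalIntegral.integral_neg]
  norm_num

lemma Rm_mul (r : ℂ × ℝ → ℂ) (hr : ContDiff ℝ 1 r) (h0 : ∀ α, r (0, α) = 0)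
    (c : ℝ) (w : ℂ) (α : ℝ) :
    c * Complex.exp w * Rm r (c, w, α) = r (c * Complex.exp w, α) := by
  have h1 : ∀ s ∈ uIcc (0:ℝ) 1, HasDerivAt (fun s : ℝ => r (((s * c : ℝ) : ℂ) * Complex.exp w, α))
      (c • fderiv ℝ r (((s * c : ℝ) : ℂ) * Complex.exp w, α) (Complex.exp w, 0)) s := by
    intro s _
    rw [← map_smul]
    refine HasFDerivAt.comp_hasDerivAt s (l := r)
      (f := fun s : ℝ => (((s * c : ℝ) : ℂ) * Complex.exp w, α))
      ((hr.differentiable (by simp)) _).hasFDerivAt ?_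
    simp only [Prod.smul_mk, smul_zero]
    refine HasDerivAt.prodMk ?_ (hasDerivAt_const _ _)
    have := ((hasDerivAt_id s).mul_const c).ofReal_comp.mul_const (Complex.exp w)
    simpa using this
  have hc : Continuous (fun s : ℝ =>
      c • fderiv ℝ r (((s * c : ℝ) : ℂ) * Complex.exp w, α) (Complex.exp w, 0)) := by
    have := hr.continuous_fderiv (by simp)
    fun_prop
  have h2 := intervalIntegral.integral_eq_sub_of_hasDerivAt h1 (hc.intervalIntegrable _ _)
  simp only [one_mul, zero_mul, Complex.ofReal_zero, h0, sub_zero] at h2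
  rw [← h2, intervalIntegral.integral_smul, Rm, Complex.real_smul, Complex.exp_neg,
    mul_assoc, mul_inv_cancel_left₀ (Complex.exp_ne_zero w)]

lemma ode_unique (f : ℂ → ℂ) (hf : ContDiff ℝ 1 f) (τ : ℝ) (y z : ℝ → ℂ)
    (hy : ∀ t ∈ Icc (0:ℝ) 1, HasDerivAt y (τ * f (y t)) t)
    (hz : ∀ t ∈ Icc (0:ℝ) 1, HasDerivAt z (τ * f (z t)) t) (h0 : y 0 = z 0) :
    EqOn y z (Icc 0 1) := by
  have cy : ContinuousOn y (Icc 0 1) := fun t ht => (hy t ht).continuousAt.continuousWithinAt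
  have cz : ContinuousOn z (Icc 0 1) := fun t ht => (hz t ht).continuousAt.continuousWithinAt
  obtain ⟨R, hR⟩ := ((isCompact_Icc.image_of_continuousOn cy).union
    (isCompact_Icc.image_of_continuousOn cz)).isBounded.subset_closedBall (0 : ℂ)
  have hg : ContDiff ℝ 1 (fun x => (τ : ℂ) * f x) := contDiff_const.mul hf
  obtain ⟨K, hK⟩ := (hg.contDiffOn (s := Metric.closedBall (0:ℂ) R)).exists_lipschitzOnWith
    (by simp) (convex_closedBall _ _) (isCompact_closedBall _ _)
  refine ODE_solution_unique_of_mem_Icc_right (v := fun _ x => (τ : ℂ) * f x) (K := K)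
    (s := fun _ => Metric.closedBall (0:ℂ) R) (fun t _ => hK) cy
    (fun t ht => (hy t (Ico_subset_Icc_self ht)).hasDerivWithinAt) ?_ cz
    (fun t ht => (hz t (Ico_subset_Icc_self ht)).hasDerivWithinAt) ?_ h0
  · exact fun t ht => hR (Or.inl ⟨t, Ico_subset_Icc_self ht, rfl⟩)
  · exact fun t ht => hR (Or.inr ⟨t, Ico_subset_Icc_self ht, rfl⟩)

lemma periodic_ext (g : ℂ → ℂ) (y : ℝ → ℂ)
    (hy : ∀ t ∈ Icc (0:ℝ) 1, HasDerivAt y (g (y t)) t) (h01 : y 0 = y 1) (t : ℝ) :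
    HasDerivAt (fun t => y (Int.fract t)) (g (y (Int.fract t))) t := by
  set n := ⌊t⌋
  have hn : (n : ℝ) ≤ t := Int.floor_le t
  have hn1 : t < n + 1 := Int.lt_floor_add_one t
  have hfr : Int.fract t = t - n := rfl
  have hshift : ∀ (m : ℤ) (d : ℂ), HasDerivAt y d (t - m) → HasDerivAt (fun s => y (s - m)) d t := by
    intro m d hd
    exact hd.comp_sub_const t (m : ℝ)
  have heq : ∀ (m : ℤ) (s : ℝ), (m : ℝ) ≤ s → s < m + 1 → y (Int.fract s) = y (s - m) := by
    intro m s h1 h2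
    rw [Int.fract, Int.floor_eq_iff.2 ⟨h1, h2⟩]
  have hder := hshift n _ (hy (t - n) ⟨by linarith, by linarith⟩)
  have hR : HasDerivWithinAt (fun t => y (Int.fract t)) (g (y (Int.fract t))) (Ici t) t := by
    rw [hfr]
    refine hder.hasDerivWithinAt.congr_of_eventuallyEq ?_ (heq n t hn hn1)
    filter_upwards [Icc_mem_nhdsGE hn1, self_mem_nhdsWithin,
      mem_nhdsWithin_of_mem_nhds (Iio_mem_nhds hn1)] with s _ hs1 hs2
    exact heq n s (hn.trans hs1) hs2
  have hL : HasDerivWithinAt (fun t => y (Int.fract t)) (g (y (Int.fract t))) (Iic t) t := by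
    rcases hn.lt_or_eq with hlt | he
    · rw [hfr]
      refine hder.hasDerivWithinAt.congr_of_eventuallyEq ?_ (heq n t hn hn1)
      filter_upwards [mem_nhdsWithin_of_mem_nhds (Iio_mem_nhds hn1),
        mem_nhdsWithin_of_mem_nhds (Ioi_mem_nhds hlt)] with s hs1 hs2
      exact heq n s (le_of_lt hs2) hs1
    · have ht0 : y (Int.fract t) = y 1 := by rw [hfr, ← he, sub_self, h01]
      have h1 : t - ((n - 1 : ℤ) : ℝ) = 1 := by push_cast; rw [← he]; ring
      have hd2 := hshift (n - 1) (g (y 1)) (by rw [h1]; exact hy 1 ⟨by norm_num, le_rfl⟩)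
      rw [ht0]
      refine hd2.hasDerivWithinAt.congr_of_eventuallyEq ?_ (by simp only [ht0, h1])
      have hlt : t - 1 < t := by linarith
      filter_upwards [self_mem_nhdsWithin,
        mem_nhdsWithin_of_mem_nhds (Ioi_mem_nhds hlt)] with s hs1 hs2
      rcases (show s ≤ t from hs1).lt_or_eq with h3 | rfl
      · have hs2' : t - 1 < s := hs2
        refine heq (n - 1) s ?_ ?_
        · push_cast; linarith
        · push_cast; linarith
      · simp only [ht0, h1]
  have := hL.union hR
  rwa [Iic_union_Ici, hasDerivWithinAt_univ] at this

lemma no_return (δ m : ℝ) (hm0 : 0 < m) (U τ : ℝ → ℝ) (x : ℝ → ℂ)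
    (hm : ∀ c ∈ Ioo 0 δ, m < τ c)
    (hret : ∀ t0, ∀ c ∈ Ioo 0 δ, x t0 = (c : ℝ) → x (t0 + τ c) = (c * Real.exp (U c) : ℝ) ∧
      ∀ s ∈ Ioo (0:ℝ) 1, ∀ r : ℝ, 0 < r → x (t0 + s * τ c) ≠ r)
    (hmono : StrictMonoOn (fun c => c * Real.exp (U c)) (Ioo 0 δ))
    (c : ℝ) (hc : c ∈ Ioo 0 δ) (hU : U c < 0) (hx : x 0 = (c : ℝ)) (t : ℝ) (ht : 0 < t) :
    x t ≠ (c : ℝ) := by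
  have key : ∀ n : ℕ, ∃ t c', n * m ≤ t ∧ c' ∈ Ioo 0 δ ∧ c' ≤ c ∧ U c' < 0 ∧ x t = (c' : ℝ) ∧
      ∀ s ∈ Ioc 0 t, x s ≠ (c : ℝ) := by
    intro n
    induction n with
    | zero => exact ⟨0, c, by simp, hc, le_rfl, hU, hx, by simp⟩
    | succ n ih =>
      obtain ⟨t, c', h1, h2, h3, h4, h5, h6⟩ := ih
      obtain ⟨r1, r2⟩ := hret t c' h2 h5
      have hlt : c' * Real.exp (U c') < c' :=
        mul_lt_of_lt_one_right h2.1 (Real.exp_lt_one_iff.2 h4)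
      have hmem : c' * Real.exp (U c') ∈ Ioo 0 δ :=
        ⟨mul_pos h2.1 (Real.exp_pos _), hlt.trans h2.2⟩
      have hτ := hm c' h2
      refine ⟨t + τ c', c' * Real.exp (U c'), ?_, hmem, by linarith, ?_, r1, ?_⟩
      · push_cast; linarith
      · have := hmono hmem h2 hlt
        simp only at this
        by_contra hcon
        have h7 := Real.one_le_exp (not_lt.1 hcon)
        nlinarith [hmem.1]
      · intro s hs
        rcases le_or_gt s t with h7 | h7
        · exact h6 s ⟨hs.1, h7⟩
        · rcases hs.2.lt_or_eq with h8 | h8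
          · have hτp : 0 < τ c' := hm0.trans hτ
            have := r2 ((s - t) / τ c') ⟨div_pos (by linarith) hτp,
              (div_lt_one hτp).2 (by linarith)⟩ c hc.1
            rwa [div_mul_cancel₀ _ hτp.ne', add_sub_cancel] at this
          · rw [h8, r1]
            intro h9
            have := Complex.ofReal_injective h9
            linarith
  obtain ⟨n, hn⟩ := exists_nat_gt (t / m)
  obtain ⟨t', c', h1, -, -, -, -, h6⟩ := key n
  refine h6 t ⟨ht, ?_⟩
  rw [div_lt_iff₀ hm0] at hn
  linarith

end Hopf

namespace Hopf

lemma not_pos_real (ε c : ℝ) (hc : 0 < c) (hε : ε = 1 ∨ ε = -1) (z : ℂ) (h0 : 0 < ε * z.im)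
    (h1 : ε * z.im < 2 * Real.pi) (r : ℝ) (hr : 0 < r) : (c : ℂ) * Complex.exp z ≠ r := by
  intro h
  have hpi := Real.pi_pos
  have hc' : (c : ℂ) ≠ 0 := by exact_mod_cast hc.ne'
  have h2 : Complex.exp z = Complex.exp ((Real.log (r / c) : ℝ) : ℂ) := by
    rw [← Complex.ofReal_exp, Real.exp_log (div_pos hr hc)]
    push_cast
    rw [eq_div_iff hc', mul_comm, h]
  obtain ⟨n, hn⟩ := Complex.exp_eq_exp_iff_exists_int.1 h2
  have h3 : z.im = n * (2 * Real.pi) := by rw [hn]; simp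
  rw [h3] at h0 h1
  rcases hε with rfl | rfl
  · have a1 : (0 : ℝ) < n := by by_contra hh; nlinarith
    have a2 : (n : ℝ) < 1 := by by_contra hh; nlinarith
    norm_cast at a1 a2; omega
  · have a1 : (n : ℝ) < 0 := by by_contra hh; nlinarith
    have a2 : (-1 : ℝ) < n := by by_contra hh; nlinarith
    have a3 : -1 < n := by exact_mod_cast a2
    norm_cast at a1; omega

lemma turn_deriv (f : ℂ → ℂ) (h : ℂ → ℂ) (c τ : ℝ)
    (hfh : ∀ z, c * Complex.exp z * h z = f (c * Complex.exp z)) (ω : ℝ → ℂ) (t : ℝ)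
    (hω : HasDerivAt ω (τ * h (ω t)) t) :
    HasDerivAt (fun s => c * Complex.exp (ω s)) (τ * f (c * Complex.exp (ω t))) t := by
  have := (hω.cexp).const_mul (c : ℂ)
  refine this.congr_deriv ?_
  rw [← hfh]
  ring

lemma turn (f : ℂ → ℂ) (hf : ContDiff ℝ 1 f) (h : ℂ → ℂ) (c τ U ε : ℝ) (hc : 0 < c)
    (hfh : ∀ z, c * Complex.exp z * h z = f (c * Complex.exp z)) (ω : ℝ → ℂ)
    (hε : ε = 1 ∨ ε = -1) (h0 : ω 0 = 0)
    (h1 : ω 1 = U + 2 * Real.pi * ε * Complex.I)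
    (hω : ∀ t ∈ Icc (0:ℝ) 1, HasDerivAt ω (τ * h (ω t)) t)
    (him : ∀ t ∈ Ioo (0:ℝ) 1, 0 < ε * (ω t).im ∧ ε * (ω t).im < 2 * Real.pi)
    (x : ℝ → ℂ) (hx : ∀ t, HasDerivAt x (f (x t)) t) (t0 : ℝ) (hx0 : x t0 = c) :
    x (t0 + τ) = (c * Real.exp U : ℝ) ∧
      ∀ s ∈ Ioo (0:ℝ) 1, ∀ r : ℝ, 0 < r → x (t0 + s * τ) ≠ r := by
  have key : EqOn (fun s => x (t0 + s * τ)) (fun s => c * Complex.exp (ω s)) (Icc 0 1) := by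
    refine ode_unique f hf τ _ _ ?_ (fun t ht => turn_deriv f h c τ hfh ω t (hω t ht)) ?_
    · intro t _
      have e1 : HasDerivAt (fun s : ℝ => t0 + s * τ) τ t := by
        simpa using ((hasDerivAt_id t).mul_const τ).const_add t0
      have := HasDerivAt.scomp t (hx (t0 + t * τ)) e1
      simpa [Function.comp_def] using this
    · simp [h0, hx0]
  constructor
  · have := key (show (1:ℝ) ∈ Icc (0:ℝ) 1 by simp)
    simp only [one_mul, h1] at this
    rw [this, Complex.exp_add]
    have : Complex.exp (2 * Real.pi * ε * Complex.I) = 1 := by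
      rw [Complex.exp_eq_one_iff]
      rcases hε with rfl | rfl
      · exact ⟨1, by push_cast; ring⟩
      · exact ⟨-1, by push_cast; ring⟩
    rw [this]; push_cast; simp
  · intro s hs r hr
    have := key (Ioo_subset_Icc_self hs)
    simp only at this
    rw [this]
    exact not_pos_real ε c hc hε _ (him s hs).1 (him s hs).2 r hr

lemma mono_lemma (U : ℝ × ℝ → ℝ) (hU : ContDiffAt ℝ 1 U (0, 0)) :
    ∃ ρ > 0, ∀ α : ℝ, |α| < ρ →
      StrictMonoOn (fun c => c * Real.exp (U (c, α))) (Ioo 0 ρ) := by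
  obtain ⟨K, t, ht, hK⟩ := hU.exists_lipschitzOnWith
  obtain ⟨ρ1, hρ1, hball⟩ := Metric.mem_nhds_iff.1 ht
  have hK0 : (0:ℝ) ≤ K := K.2
  refine ⟨min ρ1 (1 / (K + 1)), lt_min hρ1 (by positivity), ?_⟩
  intro α hα c1 h1 c2 h2 hlt
  have hm : ∀ c ∈ Ioo 0 (min ρ1 (1 / ((K:ℝ) + 1))), ((c, α) : ℝ × ℝ) ∈ t := by
    intro c hc
    apply hball
    rw [Metric.mem_ball, Prod.dist_eq, max_lt_iff]
    simp only [Real.dist_eq, sub_zero]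
    exact ⟨by rw [abs_of_pos hc.1]; exact hc.2.trans_le (min_le_left _ _),
      hα.trans_le (min_le_left _ _)⟩
  have hd := hK.dist_le_mul _ (hm c1 h1) _ (hm c2 h2)
  rw [Prod.dist_eq] at hd
  simp only [Real.dist_eq, sub_self, abs_zero] at hd
  rw [abs_sub_comm c1 c2, max_eq_left (abs_nonneg _), abs_of_pos (sub_pos.2 hlt)] at hd
  have hd2 := (abs_le.1 hd).2
  have hcK : c2 * (K + 1) < 1 := by
    have := h2.2.trans_le (min_le_right _ _)
    rwa [lt_div_iff₀ (by positivity)] at this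
  have hc2 : 0 < c2 := h2.1
  have hcK' : c2 * K < 1 := by nlinarith
  have e1 : c1 < c2 * Real.exp (U (c2, α) - U (c1, α)) := by
    have := Real.add_one_le_exp (U (c2, α) - U (c1, α))
    have e2 : c2 * (1 - K * (c2 - c1)) ≤ c2 * Real.exp (U (c2, α) - U (c1, α)) := by
      apply mul_le_mul_of_nonneg_left _ hc2.le
      linarith
    have : c2 * K * (c2 - c1) < 1 * (c2 - c1) := mul_lt_mul_of_pos_right hcK' (sub_pos.2 hlt)
    nlinarith
  have e3 := mul_lt_mul_of_pos_right e1 (Real.exp_pos (U (c1, α)))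
  rw [mul_assoc, ← Real.exp_add, sub_add_cancel] at e3
  exact e3

end Hopf

namespace Hopf

lemma per_zero (ρ m : ℝ) (hm0 : 0 < m) (U1 τ1 U2 τ2 : ℝ → ℝ) (x : ℝ → ℂ)
    (hm1 : ∀ c ∈ Ioo 0 ρ, m < τ1 c) (hm2 : ∀ c ∈ Ioo 0 ρ, m < - τ2 c)
    (hret1 : ∀ t0, ∀ c ∈ Ioo 0 ρ, x t0 = (c : ℝ) → x (t0 + τ1 c) = (c * Real.exp (U1 c) : ℝ) ∧
      ∀ s ∈ Ioo (0:ℝ) 1, ∀ r : ℝ, 0 < r → x (t0 + s * τ1 c) ≠ r)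
    (hret2 : ∀ t0, ∀ c ∈ Ioo 0 ρ, x t0 = (c : ℝ) → x (t0 + τ2 c) = (c * Real.exp (U2 c) : ℝ) ∧
      ∀ s ∈ Ioo (0:ℝ) 1, ∀ r : ℝ, 0 < r → x (t0 + s * τ2 c) ≠ r)
    (hmono1 : StrictMonoOn (fun c => c * Real.exp (U1 c)) (Ioo 0 ρ))
    (hmono2 : StrictMonoOn (fun c => c * Real.exp (U2 c)) (Ioo 0 ρ))
    (c : ℝ) (hc : 0 < c) (hc3 : c < ρ / 3) (hU : U1 c < 1) (hx : x 0 = (c : ℝ))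
    (P : ℝ) (hP : 0 < P) (hper : ∀ t, x (t + P) = x t) : U1 c = 0 := by
  have hcm : c ∈ Ioo 0 ρ := ⟨hc, by linarith⟩
  rcases lt_trichotomy (U1 c) 0 with h | h | h
  · exfalso
    refine no_return ρ m hm0 U1 τ1 x hm1 hret1 hmono1 c hcm h hx P hP ?_
    rw [← hx, ← hper 0, zero_add]
  · exact h
  · exfalso
    have he : Real.exp (U1 c) < 3 := by
      have := Real.exp_one_lt_d9
      have := Real.exp_lt_exp.2 hU
      linarith
    have he1 : 1 < Real.exp (U1 c) := Real.one_lt_exp_iff.2 h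
    set c' := c * Real.exp (U1 c) with hc'
    have hcc' : c < c' := by rw [hc']; nlinarith
    have hc'm : c' ∈ Ioo 0 ρ := ⟨hc.trans hcc', by rw [hc']; nlinarith⟩
    obtain ⟨r1, r2⟩ := hret1 0 c hcm hx
    rw [zero_add] at r1
    obtain ⟨s1, s2⟩ := hret2 _ c' hc'm r1
    have m1 := hm1 c hcm
    have m2 := hm2 c' hc'm
    have heq : τ1 c + τ2 c' = 0 := by
      by_contra hne
      rcases lt_or_gt_of_ne hne with hlt | hgt
      · have hn : τ2 c' ≠ 0 := by linarith
        have hq : 0 < - τ2 c' := by linarith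
        refine s2 (τ1 c / (- τ2 c')) ⟨by apply div_pos <;> linarith, by
          rw [div_lt_one hq]; linarith⟩ c hc ?_
        have : τ1 c + τ1 c / (- τ2 c') * τ2 c' = 0 := by field_simp; ring
        rw [this, hx]
      · have hq : 0 < τ1 c := by linarith
        refine r2 ((τ1 c + τ2 c') / τ1 c) ⟨by apply div_pos <;> linarith, by
          rw [div_lt_one hq]; linarith⟩ (c' * Real.exp (U2 c'))
          (mul_pos hc'm.1 (Real.exp_pos _)) ?_
        rw [zero_add, div_mul_cancel₀ _ hq.ne', s1]
    rw [heq, hx] at s1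
    have s3 : c = c' * Real.exp (U2 c') := by exact_mod_cast s1
    have s4 : c * Real.exp (U2 c) < c' * Real.exp (U2 c') := hmono2 hcm hc'm hcc'
    rw [← s3] at s4
    have h2 : U2 c < 0 := by
      rw [← Real.exp_lt_one_iff]; by_contra hh; push Not at hh; nlinarith
    refine no_return ρ m hm0 U2 (fun c => - τ2 c) (fun t => x (-t)) hm2 ?_ hmono2 c hcm h2
      (by simp [hx]) P hP ?_
    · intro t0 d hd hxd
      obtain ⟨a1, a2⟩ := hret2 (-t0) d hd hxd
      constructor
      · rw [← a1]; congr 1; ring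
      · intro s hs r hr
        have := a2 s hs r hr
        rw [show -(t0 + s * - τ2 d) = -t0 + s * τ2 d by ring]
        exact this
    · show x (-P) = c
      rw [← hx, ← hper (-P)]; congr 1; ring

lemma exists_per (f : ℂ → ℂ) (h : ℂ → ℂ) (c τ : ℝ) (hc : 0 < c) (hτ : 0 < τ)
    (hfh : ∀ z, c * Complex.exp z * h z = f (c * Complex.exp z)) (ω : ℝ → ℂ)
    (h0 : ω 0 = 0) (h1 : ω 1 = 2 * Real.pi * Complex.I)
    (hω : ∀ t ∈ Icc (0:ℝ) 1, HasDerivAt ω (τ * h (ω t)) t)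
    (him : ∀ t ∈ Ioo (0:ℝ) 1, 0 < (ω t).im ∧ (ω t).im < 2 * Real.pi) :
    ∃ (x : ℝ → ℂ) (P : ℝ), 0 < P ∧ x 0 = c ∧ (∀ t, HasDerivAt x (f (x t)) t) ∧
      (∀ t, x (t + P) = x t) ∧ ¬ (∀ t, x t = x 0) := by
  have hY := periodic_ext (fun z => τ * f z) (fun s => c * Complex.exp (ω s))
    (fun t ht => turn_deriv f h c τ hfh ω t (hω t ht)) (by
      simp only [h0, h1, Complex.exp_zero, Complex.exp_two_pi_mul_I])
  refine ⟨fun t => c * Complex.exp (ω (Int.fract (t / τ))), τ, hτ, by simp [h0], ?_, ?_, ?_⟩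
  · intro t
    have e1 : HasDerivAt (fun s : ℝ => s / τ) (1 / τ) t := (hasDerivAt_id t).div_const τ
    have := HasDerivAt.scomp t (hY (t / τ)) e1
    refine this.congr_deriv ?_
    have : (τ : ℂ) ≠ 0 := by exact_mod_cast hτ.ne'
    rw [Complex.real_smul]; push_cast; field_simp
  · intro t
    simp only
    rw [add_div, div_self hτ.ne', Int.fract_add_one]
  · intro hall
    have := hall (τ / 2)
    have e : Int.fract (τ / 2 / τ) = (1/2 : ℝ) := by
      rw [show τ / 2 / τ = 1/2 by field_simp, Int.fract_eq_self]; norm_num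
    simp only [e, zero_div, Int.fract_zero, h0, Complex.exp_zero, mul_one] at this
    have hh := him (1/2) (by norm_num)
    exact not_pos_real 1 c hc (Or.inl rfl) _ (by simpa using hh.1) (by simpa using hh.2) c hc this

end Hopf

namespace Hopf

lemma main_c (k : ℕ) (hk : 1 ≤ k) (κ : ℝ → ℂ) (r : ℂ × ℝ → ℂ) (hκc : ContDiff ℝ (k + 1) κ)
    (hr : ContDiff ℝ (k + 1) r) (hr0 : ∀ α, r (0, α) = 0)
    (hr1 : ∀ α z, fderiv ℝ r (0, α) (z, 0) = 0) (κ' : ℂ) (hκ : HasDerivAt κ κ' 0)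
    (hκ' : 0 < κ'.re) (γ0 : ℝ) (hγ0 : 0 < γ0) (hκ0 : κ 0 = γ0 * Complex.I) :
    ∃ ρ > (0:ℝ), ∃ δ > (0:ℝ), ∃ a : ℝ → ℝ, (∀ c, |c| < δ → ContDiffAt ℝ k a c ∧ |a c| < ρ / 2) ∧
      a 0 = 0 ∧ HasDerivAt a 0 0 ∧ ∀ α : ℝ, |α| < ρ → ∀ c : ℝ, 0 < c → c < δ →
        ((∃ (x : ℝ → ℂ) (P : ℝ), 0 < P ∧ x 0 = c ∧
          (∀ t, HasDerivAt x (κ α * x t + r (x t, α)) t) ∧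
          (∀ t, x (t + P) = x t) ∧ ¬ (∀ t, x t = x 0)) ↔ α = a c) := by
  have hpi := Real.pi_pos
  set H : ℝ × ℂ × ℝ → ℂ := fun v => κ v.2.2 + Rm r v with hHdef
  have hκk : ContDiff ℝ k κ := hκc.of_le (by exact_mod_cast Nat.le_succ k)
  have hH : ContDiff ℝ k H := (hκk.comp (by fun_prop)).add (contDiff_Rm k r hr)
  have hH0 : ∀ w α, H (0, w, α) = κ α := fun w α => by
    simp only [hHdef, Rm_zero r hr1 w α, add_zero]
  have hsym : ∀ c w α, H (-c, w, α) = H (c, w + Real.pi * Complex.I, α) := fun c w α => by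
    simp only [hHdef, Rm_neg r c w α]
  have hr1' : ContDiff ℝ 1 r := hr.of_le (by exact_mod_cast Nat.le_add_left 1 k)
  have hfh : ∀ (α c : ℝ) (z : ℂ), c * Complex.exp z * H (c, z, α) =
      κ α * (c * Complex.exp z) + r (c * Complex.exp z, α) := by
    intro α c z
    rw [← Rm_mul r hr1' hr0]; simp only [hHdef]; ring
  have hf1 : ∀ α, ContDiff ℝ 1 (fun z : ℂ => κ α * z + r (z, α)) := fun α =>
    (contDiff_const.mul contDiff_id).add (hr1'.comp (by fun_prop))
  obtain ⟨U1, τ1, ω1, cU1, zU1, ⟨L1, hL1, hL1v⟩, ev1⟩ :=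
    ret k hk H hH κ hH0 κ' hκ hsym γ0 hγ0 hκ0 1 (Or.inl rfl)
  obtain ⟨U2, τ2, ω2, cU2, zU2, -, ev2⟩ :=
    ret k hk H hH κ hH0 κ' hκ hsym γ0 hγ0 hκ0 (-1) (Or.inr rfl)
  have hco : 2 * Real.pi * 1 / γ0 * κ'.re ≠ 0 := by positivity
  obtain ⟨a, ca, a0, -, aiff, M, hM, hMv⟩ := ift_scalar k hk U1 0 0 cU1 L1 hL1 (by
    rw [hL1v, one_mul]; exact hco)
  have hk1 : (1 : WithTop ℕ∞) ≤ k := by exact_mod_cast hk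
  obtain ⟨ρ1, hρ1, mono1⟩ := mono_lemma U1 (cU1.of_le hk1)
  obtain ⟨ρ2, hρ2, mono2⟩ := mono_lemma U2 (cU2.of_le hk1)
  have evU : ∀ᶠ v in 𝓝 ((0, 0) : ℝ × ℝ), U1 v < 1 :=
    cU1.continuousAt.eventually_lt_const (by rw [zU1]; norm_num)
  obtain ⟨ρ3, hρ3, hball⟩ := Metric.eventually_nhds_iff.1 (ev1.and (ev2.and (aiff.and evU)))
  set ρ := min ρ1 (min ρ2 ρ3) with hρ
  have hρpos : 0 < ρ := lt_min hρ1 (lt_min hρ2 hρ3)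
  have hle1 : ρ ≤ ρ1 := min_le_left _ _
  have hle2 : ρ ≤ ρ2 := (min_le_right _ _).trans (min_le_left _ _)
  have hle3 : ρ ≤ ρ3 := (min_le_right _ _).trans (min_le_right _ _)
  have hin : ∀ c ∈ Ioo 0 ρ, ∀ α : ℝ, |α| < ρ → dist ((c, α) : ℝ × ℝ) (0, 0) < ρ3 := by
    intro c hc α hα
    rw [Prod.dist_eq, max_lt_iff]
    simp only [Real.dist_eq, sub_zero]
    exact ⟨by rw [abs_of_pos hc.1]; linarith [hc.2], by linarith⟩
  have evc : ∀ᶠ c in 𝓝 (0:ℝ), ContDiffAt ℝ k a c ∧ |a c| < ρ / 2 := by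
    refine (ca.eventually (by simp)).and ?_
    exact (ca.continuousAt.abs).eventually_lt_const (by show |a 0| < ρ / 2; rw [a0, abs_zero]; linarith)
  obtain ⟨δ1, hδ1, hb2⟩ := Metric.eventually_nhds_iff.1 evc
  refine ⟨ρ, hρpos, min δ1 (ρ / 3), by positivity, a, ?_, a0, ?_, ?_⟩
  · intro c hc
    exact hb2 (by rw [Real.dist_eq, sub_zero]; exact hc.trans_le (min_le_left _ _))
  · have : M 1 = 0 := by
      have := hMv 1
      rw [hL1v] at this
      exact (mul_eq_zero.1 this).resolve_right hco
    have h2 := hM.hasDerivAt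
    rwa [this] at h2
  intro α hα c hc hcδ
  have hc3 : c < ρ / 3 := hcδ.trans_le (min_le_right _ _)
  have hcm : c ∈ Ioo 0 ρ := ⟨hc, by linarith⟩
  obtain ⟨g1, g2, g3, g4⟩ := hball (hin c hcm α hα)
  rw [zU1] at g3
  constructor
  · rintro ⟨x, P, hP, hx0, hx, hper, -⟩
    have hz : U1 (c, α) = 0 := by
      refine per_zero ρ (Real.pi / γ0) (by positivity) (fun c => U1 (c, α)) (fun c => τ1 (c, α))
        (fun c => U2 (c, α)) (fun c => τ2 (c, α)) x ?_ ?_ ?_ ?_ ?_ ?_ c hc hc3 g4 hx0 P hP hper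
      · intro d hd
        have := (hball (hin d hd α hα)).1.1
        simpa using this
      · intro d hd
        have := (hball (hin d hd α hα)).2.1.1
        simpa using this
      · intro t0 d hd hxd
        obtain ⟨-, b0, b1, b2, b3⟩ := (hball (hin d hd α hα)).1
        exact turn _ (hf1 α) (fun z => H (d, z, α)) d _ _ 1 hd.1 (hfh α d) _ (Or.inl rfl)
          b0 b1 b2 b3 x hx t0 hxd
      · intro t0 d hd hxd
        obtain ⟨-, b0, b1, b2, b3⟩ := (hball (hin d hd α hα)).2.1
        exact turn _ (hf1 α) (fun z => H (d, z, α)) d _ _ (-1) hd.1 (hfh α d) _ (Or.inr rfl)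
          b0 b1 b2 b3 x hx t0 hxd
      · exact (mono1 α (hα.trans_le hle1)).mono (Ioo_subset_Ioo_right hle1)
      · exact (mono2 α (hα.trans_le hle2)).mono (Ioo_subset_Ioo_right hle2)
    exact (g3.1 hz).symm
  · intro hαc
    have hz : U1 (c, α) = 0 := g3.2 hαc.symm
    obtain ⟨b, b0, b1, b2, b3⟩ := g1
    refine exists_per (fun z => κ α * z + r (z, α)) (fun z => H (c, z, α)) c (τ1 (c, α)) hc ?_
      (hfh α c) (ω1 (c, α)) b0 ?_ b2 ?_
    · have : 0 < Real.pi / γ0 := by positivity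
      linarith
    · rw [b1, hz]; simp
    · intro t ht; simpa using b3 t ht

end Hopf

namespace Hopf

lemma fd_zero (p : ℝ → ℝ → ℝ → ℝ) 
    (hp : ContDiff ℝ 1 (fun v : ℝ × ℝ × ℝ => p v.1 v.2.1 v.2.2))
    (hpd : ∀ α, fderiv ℝ (fun v : ℝ × ℝ => p v.1 v.2 α) (0, 0) = 0) (α : ℝ) :
    HasFDerivAt (fun z : ℂ => p z.re z.im α) (0 : ℂ →L[ℝ] ℝ) 0 := by
  have hd : DifferentiableAt ℝ (fun v : ℝ × ℝ => p v.1 v.2 α) (0, 0) := by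
    have : ContDiff ℝ 1 (fun v : ℝ × ℝ => p v.1 v.2 α) :=
      hp.comp (f := fun v : ℝ × ℝ => (v.1, v.2, α)) (by fun_prop)
    exact (this.differentiable one_ne_zero).differentiableAt
  have h1 := hd.hasFDerivAt
  rw [hpd α] at h1
  have h2 : HasFDerivAt (fun z : ℂ => (z.re, z.im)) (Complex.reCLM.prod Complex.imCLM) 0 :=
    (Complex.reCLM.prod Complex.imCLM).hasFDerivAt
  have h3 := HasFDerivAt.comp (g := fun v : ℝ × ℝ => p v.1 v.2 α) (0 : ℂ) (by simpa using h1) h2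
  simpa [Function.comp_def] using h3

lemma toC_deriv (x : ℝ → ℝ × ℝ) (a b t : ℝ) (h : HasDerivAt x (a, b) t) :
    HasDerivAt (fun t => ((x t).1 : ℂ) + (x t).2 * Complex.I) (a + b * Complex.I) t := by
  have h1 : HasDerivAt (fun t => (x t).1) a t := h.fst
  have h2 : HasDerivAt (fun t => (x t).2) b t := h.snd
  exact h1.ofReal_comp.add (h2.ofReal_comp.mul_const _)

lemma ofC_deriv (x : ℝ → ℂ) (d : ℂ) (t : ℝ) (h : HasDerivAt x d t) :
    HasDerivAt (fun t => ((x t).re, (x t).im)) (d.re, d.im) t := by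
  have h1 := Complex.reCLM.hasFDerivAt.comp_hasDerivAt t h
  have h2 := Complex.imCLM.hasFDerivAt.comp_hasDerivAt t h
  exact h1.prodMk h2

end Hopf

/-- Hopf bifurcation in the plane. For a planar system
`x₁' = β(α)x₁ − γ(α)x₂ + p(x₁,x₂,α)`, `x₂' = γ(α)x₁ + β(α)x₂ + q(x₁,x₂,α)`
with `β(0) = 0`, `β'(0) > 0`, `γ(0) > 0` and higher-order terms `p, q`, there is a
`C^{k−1}` function `a` with `a(0) = a'(0) = 0` such that for `α ∈ (−σ, σ)` the orbit
through `(c, 0)` (with `c ∈ (0, δ)`) is a closed periodic orbit iff `α = a(c)`. -/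
theorem hopf_bifurcation_plane
    (k : ℕ) (hk : 3 ≤ k)
    (β γ : ℝ → ℝ) (p q : ℝ → ℝ → ℝ → ℝ)
    (hβ : ContDiff ℝ (k + 1) β) (hγ : ContDiff ℝ (k + 1) γ)
    (hp : ContDiff ℝ (k + 1) (fun v : ℝ × ℝ × ℝ => p v.1 v.2.1 v.2.2))
    (hq : ContDiff ℝ (k + 1) (fun v : ℝ × ℝ × ℝ => q v.1 v.2.1 v.2.2))
    (hp0 : ∀ α, p 0 0 α = 0) (hq0 : ∀ α, q 0 0 α = 0)
    (hpd : ∀ α, fderiv ℝ (fun v : ℝ × ℝ => p v.1 v.2 α) (0, 0) = 0)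
    (hqd : ∀ α, fderiv ℝ (fun v : ℝ × ℝ => q v.1 v.2 α) (0, 0) = 0)
    (hβ0 : β 0 = 0) (hβ'0 : 0 < deriv β 0) (hγ0 : 0 < γ 0) :
    ∃ h > (0 : ℝ), ∃ α₀ > (0 : ℝ), ∃ δ : ℝ, 0 < δ ∧ δ < h ∧
      ∃ a : ℝ → ℝ,
        ContDiffOn ℝ (k - 1) a (Ico 0 δ) ∧
        a 0 = 0 ∧
        derivWithin a (Ico 0 δ) 0 = 0 ∧
        sSup ((fun c => |a c|) '' Ico 0 δ) < α₀ ∧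
        ∀ α : ℝ, |α| < sSup ((fun c => |a c|) '' Ico 0 δ) →
          ∀ c : ℝ, 0 < c → c < δ →
            ((∃ (x : ℝ → ℝ × ℝ) (P : ℝ), 0 < P ∧ x 0 = (c, 0) ∧
                (∀ t, HasDerivAt x
                  (β α * (x t).1 - γ α * (x t).2 + p (x t).1 (x t).2 α,
                   γ α * (x t).1 + β α * (x t).2 + q (x t).1 (x t).2 α) t) ∧
                (∀ t, x (t + P) = x t) ∧
                ¬ (∀ t, x t = x 0)) ↔ α = a c) := by
  have hle : (1 : WithTop ℕ∞) ≤ k + 1 := by exact_mod_cast Nat.le_add_left 1 k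
  set κ : ℝ → ℂ := fun α => (β α : ℂ) + γ α * Complex.I with hκdef
  set r : ℂ × ℝ → ℂ := fun v =>
    (p v.1.re v.1.im v.2 : ℂ) + q v.1.re v.1.im v.2 * Complex.I with hrdef
  have hproj : ContDiff ℝ (k + 1) (fun v : ℂ × ℝ => (v.1.re, v.1.im, v.2)) :=
    (Complex.reCLM.contDiff.comp contDiff_fst).prodMk
      ((Complex.imCLM.contDiff.comp contDiff_fst).prodMk contDiff_snd)
  have hκc : ContDiff ℝ (k + 1) κ :=
    (Complex.ofRealCLM.contDiff.comp hβ).add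
      ((Complex.ofRealCLM.contDiff.comp hγ).mul contDiff_const)
  have hr : ContDiff ℝ (k + 1) r :=
    (Complex.ofRealCLM.contDiff.comp (hp.comp hproj)).add
      ((Complex.ofRealCLM.contDiff.comp (hq.comp hproj)).mul contDiff_const)
  have hr0 : ∀ α, r (0, α) = 0 := fun α => by simp [hrdef, hp0, hq0]
  have hr1 : ∀ α z, fderiv ℝ r (0, α) (z, 0) = 0 := by
    intro α z
    have e1 := Hopf.fd_zero p (hp.of_le hle) hpd α
    have e2 := Hopf.fd_zero q (hq.of_le hle) hqd α
    have e3 : HasFDerivAt (fun z : ℂ => r (z, α)) (0 : ℂ →L[ℝ] ℂ) 0 := by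
      have f1 := (Complex.ofRealCLM.hasFDerivAt (x := p (0:ℂ).re (0:ℂ).im α)).comp (0:ℂ) e1
      have f2 := (Complex.ofRealCLM.hasFDerivAt (x := q (0:ℂ).re (0:ℂ).im α)).comp (0:ℂ) e2
      have f3 := f1.add (f2.mul_const Complex.I)
      refine f3.congr_fderiv ?_
      simp
    have e4 : HasFDerivAt r (fderiv ℝ r (0, α)) (0, α) :=
      ((hr.of_le hle).differentiable one_ne_zero).differentiableAt.hasFDerivAt
    have e5 : HasFDerivAt (fun z : ℂ => (z, α)) (ContinuousLinearMap.inl ℝ ℂ ℝ) 0 :=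
      hasFDerivAt_prodMk_left 0 α
    have e6 := HasFDerivAt.comp (g := r) (0 : ℂ) e4 e5
    have := congrArg (fun L : ℂ →L[ℝ] ℂ => L z) (e6.unique e3)
    simpa using this
  have hκd : HasDerivAt κ ((deriv β 0 : ℝ) + (deriv γ 0 : ℝ) * Complex.I) 0 := by
    have b1 : HasDerivAt β (deriv β 0) 0 :=
      ((hβ.of_le hle).differentiable one_ne_zero).differentiableAt.hasDerivAt
    have b2 : HasDerivAt γ (deriv γ 0) 0 :=
      ((hγ.of_le hle).differentiable one_ne_zero).differentiableAt.hasDerivAt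
    exact b1.ofReal_comp.add (b2.ofReal_comp.mul_const _)
  obtain ⟨ρ, hρ, δ, hδ, a, ha1, ha0, had, hmain⟩ := Hopf.main_c k (by omega) κ r hκc hr hr0 hr1 _
    hκd (by simpa using hβ'0) (γ 0) hγ0 (by simp [hκdef, hβ0])
  have hmem : (0:ℝ) ∈ Ico 0 δ := ⟨le_rfl, hδ⟩
  have hsup : sSup ((fun c => |a c|) '' Ico 0 δ) ≤ ρ / 2 := by
    refine csSup_le ⟨_, 0, hmem, rfl⟩ ?_
    rintro _ ⟨c, hc, rfl⟩
    exact (ha1 c (by rw [abs_of_nonneg hc.1]; exact hc.2)).2.le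
  refine ⟨δ + 1, by linarith, ρ, hρ, δ, hδ, by linarith, a, ?_, ha0, ?_, by linarith, ?_⟩
  · intro c hc
    refine ((ha1 c (by rw [abs_of_nonneg hc.1]; exact hc.2)).1.of_le ?_).contDiffWithinAt
    have hkk : (k : WithTop ℕ∞) - 1 = ((k - 1 : ℕ) : WithTop ℕ∞) := rfl
    rw [hkk]
    exact_mod_cast Nat.sub_le k 1
  · exact had.hasDerivWithinAt.derivWithin (uniqueDiffOn_Ico 0 δ 0 hmem)
  intro α hα c hc hcδ
  rw [← hmain α (by linarith) c hc hcδ]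
  constructor
  · rintro ⟨x, P, hP, hx0, hx, hper, hnc⟩
    refine ⟨fun t => ((x t).1 : ℂ) + (x t).2 * Complex.I, P, hP, by simp [hx0], ?_, ?_, ?_⟩
    · intro t
      refine (Hopf.toC_deriv x _ _ t (hx t)).congr_deriv ?_
      apply Complex.ext <;> simp [hκdef, hrdef]
      ring
    · intro t
      simp only [hper t]
    · intro hall
      apply hnc
      intro t
      have := hall t
      have r1 := congrArg Complex.re this
      have r2 := congrArg Complex.im this
      simp at r1 r2
      exact Prod.ext r1 r2
  · rintro ⟨x, P, hP, hx0, hx, hper, hnc⟩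
    refine ⟨fun t => ((x t).re, (x t).im), P, hP, by simp [hx0], ?_, ?_, ?_⟩
    · intro t
      refine (Hopf.ofC_deriv x _ t (hx t)).congr_deriv ?_
      apply Prod.ext <;> simp [hκdef, hrdef]
      ring
    · intro t
      simp only [hper t]
    · intro hall
      apply hnc
      intro t
      have := hall t
      rw [Prod.ext_iff] at this
      exact Complex.ext this.1 this.2
end

section
/- Let n ≥ 1, T > 0, U ⊆ ℝⁿ bounded, and let f : ℝ × ℝⁿ × ℝ → ℝⁿ be of class C², T-periodic in its first variable, and bounded on bounded sets. Let f₀(x) = (1/T)∫₀^T f(t,x,0) dt, and suppose f₀ is Lipschitz on U with constant L > 0. Then there exist constants C' > 0 and α₁ > 0 such that for every α ∈ (0, α₁] and every pair of solutions x of x' = α f(t, x, α) and y of y' = α f₀(y), both with values in U on [0, 1/(αL)] and with |x(0) − y(0)| ≤ α, one has |x(t) − y(t)| ≤ C' α for all t ∈ [0, 1/(αL)]. -/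
open Set Filter intervalIntegral

/-- Lipschitz estimate for `f` in the space variable and the parameter, uniform in time. -/
theorem avg_lip
    (n : ℕ) (T : ℝ) (hT : 0 < T)
    (U : Set (Fin n → ℝ)) (hU : Bornology.IsBounded U)
    (f : ℝ → (Fin n → ℝ) → ℝ → (Fin n → ℝ))
    (hf : ContDiff ℝ 2 (fun v : ℝ × (Fin n → ℝ) × ℝ => f v.1 v.2.1 v.2.2))
    (hper : ∀ t x α, f (t + T) x α = f t x α) :
    ∃ K : ℝ, 0 ≤ K ∧ ∀ t : ℝ, ∀ x ∈ U, ∀ x' ∈ U, ∀ α ∈ Icc (0:ℝ) 1,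
      ‖f t x α - f t x' 0‖ ≤ K * (‖x - x'‖ + α) := by
  obtain ⟨R, hR⟩ := hU.subset_closedBall (0 : Fin n → ℝ)
  set S : Set (ℝ × (Fin n → ℝ) × ℝ) := Icc 0 T ×ˢ (Metric.closedBall 0 R ×ˢ Icc 0 1) with hS
  have hSc : IsCompact S :=
    isCompact_Icc.prod ((isCompact_closedBall _ _).prod isCompact_Icc)
  have hSx : Convex ℝ S :=
    (convex_Icc _ _).prod ((convex_closedBall _ _).prod (convex_Icc _ _))
  obtain ⟨K, hK⟩ := hSc.exists_bound_of_continuousOn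
    (hf.continuous_fderiv (by norm_num)).continuousOn
  refine ⟨max K 0, le_max_right _ _, ?_⟩
  intro t x hx x' hx' α hα
  have hp : Function.Periodic f T := fun t => by
    funext x α
    exact hper t x α
  obtain ⟨s, hs, hst⟩ := hp.exists_mem_Ico₀ hT t
  rw [hst]
  have h1 : (s, x, α) ∈ S := ⟨Ico_subset_Icc_self hs, hR hx, hα⟩
  have h2 : (s, x', (0:ℝ)) ∈ S := ⟨Ico_subset_Icc_self hs, hR hx', by simp⟩
  have h3 := hSx.norm_image_sub_le_of_norm_fderiv_le (𝕜 := ℝ) (C := max K 0)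
    (f := fun v : ℝ × (Fin n → ℝ) × ℝ => f v.1 v.2.1 v.2.2)
    (fun v _ => (hf.differentiable (by norm_num)) v)
    (fun v hv => (hK v hv).trans (le_max_left _ _)) h2 h1
  refine h3.trans (mul_le_mul_of_nonneg_left ?_ (le_max_right _ _))
  have hα0 : |α| = α := abs_of_nonneg hα.1
  simp only [Prod.mk_sub_mk, Prod.norm_mk, sub_self, norm_zero, sub_zero, Real.norm_eq_abs, hα0]
  have := norm_nonneg (x - x')
  exact max_le (by linarith [hα.1]) (max_le (by linarith [hα.1]) (by linarith))

/-- Sum over whole periods plus a remainder. -/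
theorem avg_period {E : Type*} [NormedAddCommGroup E] (h : ℝ → E) (T τ P Q : ℝ) (hT : 0 < T)
    (hQ : 0 ≤ Q) (hP : 0 ≤ P) (h0 : h 0 = 0)
    (h1 : ∀ a b, 0 ≤ a → a ≤ b → b ≤ τ → ‖h b - h a‖ ≤ P * (b - a))
    (h2 : ∀ a, 0 ≤ a → a + T ≤ τ → ‖h (a + T) - h a‖ ≤ Q) :
    ∀ t ∈ Icc 0 τ, ‖h t‖ ≤ t / T * Q + P * T := by
  intro t ht
  have key : ∀ k : ℕ, (k : ℝ) * T ≤ τ → ‖h (k * T)‖ ≤ k * Q := by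
    intro k
    induction k with
    | zero => intro _; simp [h0]
    | succ k ih =>
      intro hk
      push_cast at hk ⊢
      have e : ((k : ℝ) + 1) * T = k * T + T := by ring
      rw [e] at hk ⊢
      have a1 := ih (by linarith)
      have a2 := h2 (k * T) (by positivity) hk
      have a3 := norm_le_norm_add_norm_sub' (h (k * T + T)) (h (k * T))
      linarith
  have hk1 : (⌊t / T⌋₊ : ℝ) ≤ t / T := Nat.floor_le (div_nonneg ht.1 hT.le)
  have hk2 : t / T < ⌊t / T⌋₊ + 1 := Nat.lt_floor_add_one _
  set k := ⌊t / T⌋₊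
  have hk3 : (k : ℝ) * T ≤ t := (le_div_iff₀ hT).1 hk1
  have hk4 : t < (k + 1) * T := (div_lt_iff₀ hT).1 hk2
  have a1 := key k (hk3.trans ht.2)
  have a2 := h1 (k * T) t (by positivity) hk3 ht.2
  have a3 := norm_le_norm_add_norm_sub' (h t) (h (k * T))
  have a4 : P * (t - k * T) ≤ P * T := mul_le_mul_of_nonneg_left (by linarith) hP
  have a5 := mul_le_mul_of_nonneg_right hk1 hQ
  linarith

/-- Solutions of `x' = α f(t,x,α)` and of the averaged system
`y' = α f₀(y)` that start `O(α)`-close remain `O(α)`-close on the time scale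
`[0, 1/(αL)]`. -/
theorem averaging_closeness
    (n : ℕ) (hn : 1 ≤ n) (T : ℝ) (hT : 0 < T)
    (U : Set (Fin n → ℝ)) (hU : Bornology.IsBounded U)
    (f : ℝ → (Fin n → ℝ) → ℝ → (Fin n → ℝ))
    (hf : ContDiff ℝ 2 (fun v : ℝ × (Fin n → ℝ) × ℝ => f v.1 v.2.1 v.2.2))
    (hper : ∀ t x α, f (t + T) x α = f t x α)
    (hbdd : ∀ B : Set (Fin n → ℝ), Bornology.IsBounded B →
      ∃ M : ℝ, ∀ t : ℝ, ∀ x ∈ B, ∀ α ∈ Icc (0:ℝ) 1, ‖f t x α‖ ≤ M)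
    (f₀ : (Fin n → ℝ) → (Fin n → ℝ))
    (hf₀ : ∀ x, f₀ x = (1 / T) • ∫ t in (0:ℝ)..T, f t x 0)
    (L : ℝ) (hL : 0 < L)
    (hlip : LipschitzOnWith (Real.toNNReal L) f₀ U) :
    ∃ C' > (0 : ℝ), ∃ α₁ > (0 : ℝ), ∀ α : ℝ, 0 < α → α ≤ α₁ →
      ∀ x y : ℝ → Fin n → ℝ,
        (∀ t ∈ Icc (0:ℝ) (1 / (α * L)), HasDerivAt x (α • f t (x t) α) t) →
        (∀ t ∈ Icc (0:ℝ) (1 / (α * L)), HasDerivAt y (α • f₀ (y t)) t) →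
        (∀ t ∈ Icc (0:ℝ) (1 / (α * L)), x t ∈ U) →
        (∀ t ∈ Icc (0:ℝ) (1 / (α * L)), y t ∈ U) →
        ‖x 0 - y 0‖ ≤ α →
        ∀ t ∈ Icc (0:ℝ) (1 / (α * L)), ‖x t - y t‖ ≤ C' * α := by
  obtain ⟨K, hK0, hK⟩ := avg_lip n T hT U hU f hf hper
  obtain ⟨M', hM'⟩ := hbdd U hU
  obtain ⟨M, hM0, hM⟩ : ∃ M : ℝ, 0 ≤ M ∧ ∀ t : ℝ, ∀ x ∈ U, ∀ α ∈ Icc (0:ℝ) 1, ‖f t x α‖ ≤ M :=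
    ⟨max M' 0, le_max_right _ _, fun t x hx α hα => (hM' t x hx α hα).trans (le_max_left _ _)⟩
  have hM₀ : ∀ x ∈ U, ‖f₀ x‖ ≤ M := by
    intro x hx
    rw [hf₀, norm_smul, Real.norm_of_nonneg (by positivity)]
    have := intervalIntegral.norm_integral_le_of_norm_le_const (a := 0) (b := T) (C := M)
      (f := fun t => f t x 0) (fun t _ => hM t x hx 0 (by simp))
    rw [sub_zero, abs_of_pos hT] at this
    calc 1 / T * ‖∫ t in (0:ℝ)..T, f t x 0‖ ≤ 1 / T * (M * T) := by gcongr
      _ = M := by field_simp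
  have hlip' : ∀ a ∈ U, ∀ b ∈ U, ‖f₀ a - f₀ b‖ ≤ L * ‖a - b‖ := by
    intro a ha b hb
    have := hlip.norm_sub_le ha hb
    rwa [Real.coe_toNNReal _ hL.le] at this
  set C1 := K * (M * T + 1) + L * (M * T) with hC1
  have hC10 : 0 ≤ C1 := by positivity
  set C2 := C1 / L + 2 * M * T with hC2
  have hC20 : 0 ≤ C2 := by positivity
  refine ⟨Real.exp 1 + C2 * Real.exp 1, by positivity, 1, one_pos, ?_⟩
  intro α hα hα1 x y hx hy hxU hyU hxy
  set τ := 1 / (α * L) with hτ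
  have hτ0 : 0 < τ := by positivity
  have hατ : α * L * τ = 1 := by rw [hτ]; field_simp
  have hαm : α ∈ Icc (0:ℝ) 1 := ⟨hα.le, hα1⟩
  have hxc : ContinuousOn x (Icc 0 τ) := fun t ht => (hx t ht).continuousAt.continuousWithinAt
  have hFc : ContinuousOn (fun t => f₀ (x t)) (Icc 0 τ) := hlip.continuousOn.comp hxc hxU
  obtain ⟨F, hF, hFe⟩ : ∃ F : ℝ → Fin n → ℝ, Continuous F ∧ ∀ t ∈ Icc 0 τ, F t = f₀ (x t) := by
    refine ⟨IccExtend hτ0.le ((Icc 0 τ).restrict fun t => f₀ (x t)),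
      (continuousOn_iff_continuous_restrict.1 hFc).Icc_extend', fun t ht => ?_⟩
    rw [IccExtend_of_mem _ _ ht]
    rfl
  set G : ℝ → Fin n → ℝ := fun t => ∫ s in (0:ℝ)..t, F s with hG
  have hGd : ∀ t, HasDerivAt G (F t) t := fun t => (hF.integral_hasStrictDerivAt 0 t).hasDerivAt
  set h : ℝ → Fin n → ℝ := fun t => x t - x 0 - α • G t with hh
  have hhd : ∀ t ∈ Icc 0 τ, HasDerivAt h (α • f t (x t) α - α • f₀ (x t)) t := by
    intro t ht
    have := ((hx t ht).sub_const (x 0)).sub ((hGd t).const_smul α)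
    rw [hFe t ht] at this
    exact this
  -- slow variation of `x`
  have hslow : ∀ a b, 0 ≤ a → a ≤ b → b ≤ τ → ‖x b - x a‖ ≤ α * M * (b - a) := by
    intro a b ha hab hb
    refine norm_image_sub_le_of_norm_deriv_le_segment' (f := x) (a := a) (b := b)
      (f' := fun t => α • f t (x t) α)
      (fun t ht => (hx t ⟨ha.trans ht.1, ht.2.trans hb⟩).hasDerivWithinAt) ?_ b ⟨hab, le_rfl⟩
    intro t ht
    have := hM t (x t) (hxU t ⟨ha.trans ht.1, ht.2.le.trans hb⟩) α hαm
    rw [norm_smul, Real.norm_of_nonneg hα.le]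
    gcongr
  have hh1 : ∀ a b, 0 ≤ a → a ≤ b → b ≤ τ → ‖h b - h a‖ ≤ 2 * M * α * (b - a) := by
    intro a b ha hab hb
    refine norm_image_sub_le_of_norm_deriv_le_segment' (f := h) (a := a) (b := b)
      (f' := fun t => α • f t (x t) α - α • f₀ (x t))
      (fun t ht => (hhd t ⟨ha.trans ht.1, ht.2.trans hb⟩).hasDerivWithinAt) ?_ b ⟨hab, le_rfl⟩
    intro t ht
    have hU' := hxU t ⟨ha.trans ht.1, ht.2.le.trans hb⟩
    have b1 := hM t (x t) hU' α hαm
    have b2 := hM₀ (x t) hU'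
    rw [← smul_sub, norm_smul, Real.norm_of_nonneg hα.le]
    have b3 := norm_sub_le (f t (x t) α) (f₀ (x t))
    calc α * ‖f t (x t) α - f₀ (x t)‖ ≤ α * (M + M) := by gcongr; linarith
      _ = 2 * M * α := by ring
  have hh2 : ∀ a, 0 ≤ a → a + T ≤ τ → ‖h (a + T) - h a‖ ≤ α * α * C1 * T := by
    intro a ha haT
    have haU : x a ∈ U := hxU a ⟨ha, by linarith⟩
    have hgc : Continuous (fun s => f s (x a) 0) :=
      hf.continuous.comp (f := fun s : ℝ => (s, x a, (0:ℝ))) (by fun_prop)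
    have hmean : ∫ s in a..(a + T), (f s (x a) 0 - f₀ (x a)) = 0 := by
      rw [intervalIntegral.integral_sub (hgc.intervalIntegrable _ _)
        intervalIntegrable_const, intervalIntegral.integral_const]
      have hp : Function.Periodic (fun s => f s (x a) 0) T := fun s => hper s _ _
      rw [hp.intervalIntegral_add_eq a 0, hf₀, zero_add, smul_smul]
      have : (a + T - a) * (1 / T) = 1 := by field_simp; ring
      rw [this, one_smul, sub_self]
    set p : ℝ → Fin n → ℝ :=
      fun t => h t - α • ∫ s in a..t, (f s (x a) 0 - f₀ (x a)) with hp
    have hpd : ∀ t ∈ Icc a (a + T), HasDerivAt p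
        (α • f t (x t) α - α • f₀ (x t) - α • (f t (x a) 0 - f₀ (x a))) t := by
      intro t ht
      have hc : Continuous (fun s => f s (x a) 0 - f₀ (x a)) := hgc.sub continuous_const
      exact (hhd t ⟨ha.trans ht.1, ht.2.trans haT⟩).sub
        (((hc.integral_hasStrictDerivAt a t).hasDerivAt).const_smul α)
    have := norm_image_sub_le_of_norm_deriv_le_segment' (f := p) (a := a) (b := a + T)
      (C := α * α * C1)
      (fun t ht => (hpd t ht).hasDerivWithinAt) ?_ (a + T) ⟨by linarith, le_rfl⟩
    · simpa [hp, hmean] using this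
    intro t ht
    have htτ : t ≤ τ := ht.2.le.trans haT
    have htU : x t ∈ U := hxU t ⟨ha.trans ht.1, htτ⟩
    have b0 : ‖x t - x a‖ ≤ α * (M * T) := by
      refine (hslow a t ha ht.1 htτ).trans ?_
      rw [mul_assoc]
      have : t - a ≤ T := by linarith [ht.2]
      gcongr
    have b1 := hK t (x t) htU (x a) haU α hαm
    have b2 := hlip' (x t) htU (x a) haU
    have e : α • f t (x t) α - α • f₀ (x t) - α • (f t (x a) 0 - f₀ (x a))
        = α • ((f t (x t) α - f t (x a) 0) - (f₀ (x t) - f₀ (x a))) := by module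
    rw [e, norm_smul, Real.norm_of_nonneg hα.le, mul_assoc]
    refine mul_le_mul_of_nonneg_left ?_ hα.le
    refine (norm_sub_le _ _).trans ?_
    calc _ ≤ K * (α * (M * T) + α) + L * (α * (M * T)) :=
          add_le_add (b1.trans (by gcongr)) (b2.trans (by gcongr))
      _ = α * C1 := by rw [hC1]; ring
  have hhb : ∀ t ∈ Icc 0 τ, ‖h t‖ ≤ α * C2 := by
    intro t ht
    refine (avg_period h T τ (2 * M * α) (α * α * C1 * T) hT (by positivity) (by positivity)
      (by simp [hh, hG]) hh1 hh2 t ht).trans ?_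
    have e : t / T * (α * α * C1 * T) = α * α * C1 * t := by field_simp
    have e2 : α * C2 = α * α * C1 * τ + 2 * M * α * T := by
      rw [hC2, hτ]; field_simp
    rw [e, e2]
    have := ht.2
    gcongr
  -- Gronwall
  have hgr := norm_le_gronwallBound_of_norm_deriv_right_le
    (f := fun t => x t - y t - h t)
    (f' := fun t => α • (f₀ (x t) - f₀ (y t))) (δ := α) (K := α * L) (ε := α * L * (α * C2))
    (a := 0) (b := τ)
  have hwd : ∀ t ∈ Icc 0 τ, HasDerivAt (fun t => x t - y t - h t)
      (α • (f₀ (x t) - f₀ (y t))) t := by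
    intro t ht
    have := ((hx t ht).sub (hy t ht)).sub (hhd t ht)
    refine this.congr_deriv ?_
    module
  have hgr' := hgr (fun t ht => (hwd t ht).continuousAt.continuousWithinAt)
    (fun t ht => (hwd t (Ico_subset_Icc_self ht)).hasDerivWithinAt)
    (by simpa [hh, hG] using hxy)
    (by
      intro t ht'
      have ht := Ico_subset_Icc_self ht'
      rw [norm_smul, Real.norm_of_nonneg hα.le]
      have b1 := hlip' _ (hxU t ht) _ (hyU t ht)
      have b2 := hhb t ht
      have b3 : ‖x t - y t‖ ≤ ‖x t - y t - h t‖ + α * C2 := by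
        have := norm_le_norm_add_norm_sub' (x t - y t) (h t)
        linarith
      calc _ ≤ α * (L * (‖x t - y t - h t‖ + α * C2)) := by
            gcongr
            exact b1.trans (by gcongr)
        _ = _ := by ring)
  intro t ht
  have hg := hgr' t ht
  rw [gronwallBound_of_K_ne_0 (by positivity)] at hg
  have hq : α * L * (α * C2) / (α * L) = α * C2 := by field_simp
  simp only [sub_zero, hq] at hg
  have hexp : Real.exp (α * L * t) ≤ Real.exp 1 := by
    rw [Real.exp_le_exp, ← hατ]
    have := ht.2
    gcongr
  have b2 := hhb t ht
  have b3 := norm_le_norm_add_norm_sub' (x t - y t) (h t)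
  have b4 : α * Real.exp (α * L * t) ≤ α * Real.exp 1 := by gcongr
  have b5 : α * C2 * (Real.exp (α * L * t) - 1) ≤ α * C2 * (Real.exp 1 - 1) := by gcongr
  nlinarith [b2, b3, b4, b5, hg]
end

section
/- Let n ≥ 1, T > 0, and let f : ℝ × ℝⁿ × ℝ → ℝⁿ be of class C² and T-periodic in its first variable. Let f₀(x) = (1/T)∫₀^T f(t,x,0) dt, and suppose y* ∈ ℝⁿ is a hyperbolic equilibrium of the averaged system y' = α f₀(y), i.e. f₀(y*) = 0 and no eigenvalue of the Jacobian D f₀(y*) has zero real part. Then there exist α₀ > 0 and a neighborhood N of y* such that for every α ∈ (0, α₀] the equation x' = α f(t, x, α) has a unique T-periodic solution x(·, α) with values in N; moreover x(t, α) is continuous in (t, α) and x(t, α) → y* uniformly in t as α → 0⁺. -/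
open Set Filter Topology intervalIntegral

set_option linter.unusedSectionVars false

namespace AvgAux

variable {E W : Type*} [NormedAddCommGroup E] [NormedSpace ℝ E]
  [NormedAddCommGroup W] [NormedSpace ℝ W]
variable {K : Type*} [TopologicalSpace K] [CompactSpace K]

/-- Constant functions, as a continuous linear map. -/
noncomputable def constL (K E : Type*) [TopologicalSpace K] [CompactSpace K]
    [NormedAddCommGroup E] [NormedSpace ℝ E] : E →L[ℝ] C(K, E) :=
  LinearMap.mkContinuous
    { toFun := fun v => ContinuousMap.const K v
      map_add' := fun _ _ => rfl
      map_smul' := fun _ _ => rfl } 1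
    (fun v => by
      rw [ContinuousMap.norm_le _ (by positivity)]
      intro k
      rw [one_mul]
      exact le_refl ‖v‖)

@[simp] theorem constL_apply (v : E) (k : K) : constL K E v k = v := rfl

/-- The superposition operator. -/
def sup (g : K → E × ℝ → W) (hg : Continuous (fun p : K × (E × ℝ) => g p.1 p.2))
    (p : ℝ × C(K, E)) : C(K, W) :=
  ⟨fun k => g k (p.2 k, p.1), by
    exact hg.comp (continuous_id.prodMk (p.2.continuous.prodMk continuous_const))⟩

theorem sup_apply (g : K → E × ℝ → W) (hg : Continuous (fun p : K × (E × ℝ) => g p.1 p.2))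
    (p : ℝ × C(K, E)) (k : K) : sup g hg p k = g k (p.2 k, p.1) := rfl

/-- Multiplication operator. -/
noncomputable def mulOp (G : C(K, E × ℝ →L[ℝ] W)) : ℝ × C(K, E) →L[ℝ] C(K, W) :=
  LinearMap.mkContinuous
    { toFun := fun p => ⟨fun k => G k (p.2 k, p.1), by
        exact G.continuous.clm_apply (p.2.continuous.prodMk continuous_const)⟩
      map_add' := fun p q => by
        ext k
        change G k (p.2 k + q.2 k, p.1 + q.1) = G k (p.2 k, p.1) + G k (q.2 k, q.1)
        rw [← map_add]; rfl
      map_smul' := fun c p => by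
        ext k
        change G k (c • p.2 k, c • p.1) = c • G k (p.2 k, p.1)
        rw [← ContinuousLinearMap.map_smul]; rfl } ‖G‖
    (fun p => by
      rw [ContinuousMap.norm_le _ (by positivity)]
      intro k
      change ‖G k (p.2 k, p.1)‖ ≤ _
      refine (ContinuousLinearMap.le_opNorm _ _).trans ?_
      gcongr
      · exact G.norm_coe_le_norm k
      · rw [Prod.norm_def, Prod.norm_def]
        exact max_le ((p.2.norm_coe_le_norm k).trans (le_max_right _ _)) (le_max_left _ _))

theorem mulOp_apply (G : C(K, E × ℝ →L[ℝ] W)) (p : ℝ × C(K, E)) (k : K) :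
    mulOp G p k = G k (p.2 k, p.1) := rfl

theorem sup_hasStrict (g : K → E × ℝ → W) (hg : Continuous (fun p : K × (E × ℝ) => g p.1 p.2))
    (g' : K → E × ℝ → (E × ℝ →L[ℝ] W)) (hg' : Continuous (fun p : K × (E × ℝ) => g' p.1 p.2))
    (hd : ∀ k v, HasFDerivAt (g k) (g' k v) v) (v : E) (a : ℝ) :
    HasStrictFDerivAt (sup g hg)
      (mulOp ⟨fun k => g' k (v, a), hg'.comp (continuous_id.prodMk continuous_const)⟩)
      (a, constL K E v) := by
  refine HasStrictFDerivAt.of_isLittleO ?_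
  rw [Asymptotics.isLittleO_iff]
  intro c hc
  -- uniform closeness of the derivative
  have h1 : ∀ᶠ w in 𝓝 (v, a), ∀ k : K, ‖g' k w - g' k (v, a)‖ < c := by
    have : ∀ k ∈ (univ : Set K), ∀ᶠ z : (E × ℝ) × K in 𝓝 ((v, a), k),
        ‖g' z.2 z.1 - g' z.2 (v, a)‖ < c := by
      intro k _
      have hcont : Continuous (fun z : (E × ℝ) × K => ‖g' z.2 z.1 - g' z.2 (v, a)‖) := by
        refine Continuous.norm (Continuous.sub ?_ ?_)
        · exact hg'.comp (continuous_snd.prodMk continuous_fst)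
        · exact hg'.comp (continuous_snd.prodMk continuous_const)
      refine hcont.continuousAt.eventually_lt continuousAt_const ?_
      simpa using hc
    have := isCompact_univ.eventually_forall_of_forall_eventually
      (P := fun w k => ‖g' k w - g' k (v, a)‖ < c) this
    filter_upwards [this] with w hw k using hw k (mem_univ k)
  obtain ⟨δ, hδ, hball⟩ := Metric.eventually_nhds_iff_ball.1 h1
  have h2 : ∀ᶠ p : (ℝ × C(K, E)) × (ℝ × C(K, E)) in 𝓝 ((a, constL K E v), (a, constL K E v)),
      p.1 ∈ Metric.ball (a, constL K E v) δ ∧ p.2 ∈ Metric.ball (a, constL K E v) δ := by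
    rw [nhds_prod_eq]
    exact prod_mem_prod (Metric.ball_mem_nhds _ hδ) (Metric.ball_mem_nhds _ hδ)
  filter_upwards [h2] with p hp
  have key : ∀ (q : ℝ × C(K, E)), q ∈ Metric.ball (a, constL K E v) δ → ∀ k,
      (q.2 k, q.1) ∈ Metric.ball (v, a) δ := by
    intro q hq k
    rw [mem_ball_iff_norm] at hq ⊢
    refine lt_of_le_of_lt ?_ hq
    rw [Prod.norm_def, Prod.norm_def]
    exact max_le (((q.2 - constL K E v).norm_coe_le_norm k).trans (le_max_right _ _))
      (le_max_left _ _)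
  rw [ContinuousMap.norm_le _ (by positivity)]
  intro k
  have := (convex_ball (v, a) δ).norm_image_sub_le_of_norm_hasFDerivWithin_le'
    (f := g k) (f' := g' k) (φ := g' k (v, a)) (C := c)
    (fun x _ => (hd k x).hasFDerivWithinAt) (fun x hx => (hball x hx k).le)
    (key p.2 hp.2 k) (key p.1 hp.1 k)
  change ‖g k (p.1.2 k, p.1.1) - g k (p.2.2 k, p.2.1)
    - g' k (v, a) ((p.1.2 k, p.1.1) - (p.2.2 k, p.2.1))‖ ≤ _
  refine this.trans ?_
  gcongr
  rw [Prod.norm_def, Prod.norm_def]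
  exact max_le (((p.1.2 - p.2.2).norm_coe_le_norm k).trans (le_max_right _ _))
      (le_max_left _ _)

theorem bij (k0 : K) (l : C(K, E) →L[ℝ] E)
    (hl : Function.Bijective (fun v => l (constL K E v))) (D : C(K, E) →L[ℝ] C(K, E))
    (hD : ∀ h, D h = h - constL K E (h k0) + constL K E (l h)) :
    Function.Bijective D := by
  constructor
  · rw [injective_iff_map_eq_zero]
    intro h hh
    rw [hD] at hh
    have h0 : l h = 0 := by
      have := congrArg (fun x => x k0) hh
      simpa using this
    have h1 : h = constL K E (h k0) := by
      rw [h0, map_zero, add_zero, sub_eq_zero] at hh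
      exact hh
    have h2 : h k0 = 0 := by
      apply hl.1
      change l (constL K E (h k0)) = l (constL K E 0)
      rw [← h1, h0]; simp
    rw [h1, h2, map_zero]
  · intro g
    obtain ⟨v, hv⟩ := hl.2 (g k0 - l (g - constL K E (g k0)))
    refine ⟨constL K E v + (g - constL K E (g k0)), ?_⟩
    have h1 : l (constL K E v + (g - constL K E (g k0))) = g k0 := by
      rw [map_add]
      change (fun v => l (constL K E v)) v + _ = _
      rw [hv]; abel
    rw [hD, h1]
    ext k
    simp

/-- Integration. -/
noncomputable def intOp (T : ℝ) (hT : 0 ≤ T) (E : Type*)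
    [NormedAddCommGroup E] [NormedSpace ℝ E] : C(Icc 0 T, E) →L[ℝ] C(Icc 0 T, E) :=
  LinearMap.mkContinuous
    { toFun := fun x => ⟨fun t => ∫ s in (0:ℝ)..t, IccExtend hT x s, by
        have h : Continuous (IccExtend hT x) := x.continuous.Icc_extend'
        exact (intervalIntegral.continuous_primitive
          (fun a b => h.intervalIntegrable a b) 0).comp continuous_subtype_val⟩
      map_add' := fun x y => by
        ext t
        have hx : Continuous (IccExtend hT x) := x.continuous.Icc_extend'
        have hy : Continuous (IccExtend hT y) := y.continuous.Icc_extend'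
        exact intervalIntegral.integral_add (hx.intervalIntegrable _ _)
          (hy.intervalIntegrable _ _)
      map_smul' := fun c x => by
        ext t
        exact intervalIntegral.integral_smul c _ } T
    (fun x => by
      rw [ContinuousMap.norm_le _ (by positivity)]
      intro t
      change ‖∫ s in (0:ℝ)..t, IccExtend hT x s‖ ≤ _
      have := intervalIntegral.norm_integral_le_of_norm_le_const (a := 0) (b := (t:ℝ))
        (f := IccExtend hT x) (C := ‖x‖) (fun s _ => x.norm_coe_le_norm _)
      refine this.trans ?_
      rw [sub_zero, abs_of_nonneg t.2.1, mul_comm]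
      gcongr
      exact t.2.2)

theorem intOp_apply (T : ℝ) (hT : 0 ≤ T) (x : C(Icc 0 T, E)) (t : Icc (0:ℝ) T) :
    intOp T hT E x t = ∫ s in (0:ℝ)..t, IccExtend hT x s := rfl

/-- The map whose zeros are the periodic solutions. -/
noncomputable def Fmap (T : ℝ) (hT : 0 ≤ T) (g : Icc 0 T → E × ℝ → E)
    (hg : Continuous (fun p : Icc 0 T × (E × ℝ) => g p.1 p.2)) (p : ℝ × C(Icc 0 T, E)) :
    C(Icc 0 T, E) :=
  p.2 - constL _ E (p.2 ⟨0, le_refl 0, hT⟩) - p.1 • intOp T hT E (sup g hg p)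
    + constL _ E ((1 / T) • (intOp T hT E (sup g hg p) ⟨T, hT, le_refl T⟩))

theorem int_sup_eq (T : ℝ) (hT : 0 ≤ T) (f : ℝ → E → ℝ → E)
    (hg : Continuous (fun p : Icc 0 T × (E × ℝ) => f p.1 p.2.1 p.2.2))
    (p : ℝ × C(Icc 0 T, E)) (X : ℝ → E) (hX : ∀ t ∈ Icc 0 T, X t = IccExtend hT p.2 t)
    (t : Icc (0:ℝ) T) :
    intOp T hT E (sup (fun k w => f k w.1 w.2) hg p) t = ∫ s in (0:ℝ)..t, f s (X s) p.1 := by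
  rw [intOp_apply]
  apply intervalIntegral.integral_congr
  intro s hs
  rw [uIcc_of_le t.2.1] at hs
  have hs' : s ∈ Icc 0 T := ⟨hs.1, hs.2.trans t.2.2⟩
  simp only
  rw [hX s hs', IccExtend_of_mem hT _ hs', IccExtend_of_mem hT _ hs']
  rfl

/-- Periodic extension. -/
noncomputable def pext (T : ℝ) (hT : 0 < T) (x : C(Icc 0 T, E)) (t : ℝ) : E :=
  x ⟨toIcoMod hT 0 t, Ico_subset_Icc_self (toIcoMod_mem_Ico' hT t)⟩

theorem pext_per (T : ℝ) (hT : 0 < T) (x : C(Icc 0 T, E)) (t : ℝ) :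
    pext T hT x (t + T) = pext T hT x t := by
  simp [pext]

theorem pext_of_mem (T : ℝ) (hT : 0 < T) (x : C(Icc 0 T, E))
    (h : x ⟨0, le_refl 0, hT.le⟩ = x ⟨T, hT.le, le_refl T⟩) (t : ℝ) (ht : t ∈ Icc 0 T) :
    pext T hT x t = x ⟨t, ht⟩ := by
  rcases eq_or_lt_of_le ht.2 with h1 | h1
  · subst h1
    rw [← h, pext]
    refine congrArg x (Subtype.ext ?_)
    have h2 := toIcoMod_apply_right hT 0
    rwa [zero_add] at h2
  · unfold pext
    congr 2
    rw [toIcoMod_eq_self]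
    exact ⟨ht.1, by simpa using h1⟩

theorem pext_cont (T : ℝ) (hT : 0 < T) (x : C(Icc 0 T, E))
    (h : x ⟨0, le_refl 0, hT.le⟩ = x ⟨T, hT.le, le_refl T⟩) : Continuous (pext T hT x) := by
  have : Fact (0 < T) := ⟨hT⟩
  have h1 : Continuous (AddCircle.liftIco T 0 (IccExtend hT.le x)) := by
    apply AddCircle.liftIco_zero_continuous
    · rw [IccExtend_of_mem hT.le _ ⟨le_refl 0, hT.le⟩, IccExtend_of_mem hT.le _ ⟨hT.le, le_refl T⟩]
      exact h
    · exact (x.continuous.Icc_extend').continuousOn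
  have h2 : pext T hT x =
      fun t : ℝ => AddCircle.liftIco T 0 (IccExtend hT.le x) (t : AddCircle T) := by
    ext1 t
    have h3 : (t : AddCircle T) = ((toIcoMod hT 0 t : ℝ) : AddCircle T) := by
      rw [← self_sub_toIcoDiv_zsmul hT 0 t, AddCircle.coe_sub, AddCircle.coe_zsmul,
        AddCircle.coe_period, smul_zero, sub_zero]
    rw [h3, AddCircle.liftIco_zero_coe_apply (toIcoMod_mem_Ico' hT t),
      IccExtend_of_mem hT.le _ (Ico_subset_Icc_self (toIcoMod_mem_Ico' hT t))]
    rfl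
  rw [h2]
  exact h1.comp (AddCircle.continuous_mk' T)

theorem per_eq (T : ℝ) (hT : 0 < T) (G H : ℝ → E) (hG : ∀ t, G (t + T) = G t)
    (hH : ∀ t, H (t + T) = H t) (h : ∀ t ∈ Icc 0 T, G t = H t) : G = H := by
  ext1 t
  have hG' : Function.Periodic G T := hG
  have hH' : Function.Periodic H T := hH
  have h1 : toIcoMod hT 0 t = t - toIcoDiv hT 0 t • T := rfl
  rw [← hG'.sub_zsmul_eq (toIcoDiv hT 0 t), ← hH'.sub_zsmul_eq (toIcoDiv hT 0 t), ← h1]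
  exact h _ (Ico_subset_Icc_self (toIcoMod_mem_Ico' hT t))

theorem Fmap_zero (T : ℝ) (hT : 0 < T) (f : ℝ → E → ℝ → E)
    (hg : Continuous (fun p : Icc 0 T × (E × ℝ) => f p.1 p.2.1 p.2.2))
    (α : ℝ) (x : C(Icc 0 T, E))
    (h : Fmap T hT.le (fun k w => f k w.1 w.2) hg (α, x) = 0) :
    x ⟨0, le_refl 0, hT.le⟩ = x ⟨T, hT.le, le_refl T⟩ ∧
    (∫ s in (0:ℝ)..T, f s (pext T hT x s) α) = 0 ∧
    ∀ t, ∀ ht : t ∈ Icc 0 T, x ⟨t, ht⟩ = x ⟨0, le_refl 0, hT.le⟩ +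
      α • ∫ s in (0:ℝ)..t, f s (pext T hT x s) α := by
  set S := intOp T hT.le E (sup (fun k w => f k w.1 w.2) hg (α, x)) with hS
  have hp : ∀ t : Icc 0 T, x t - x ⟨0, le_refl 0, hT.le⟩ - α • S t +
      (1 / T) • S ⟨T, hT.le, le_refl T⟩ = 0 := fun t => congrArg (fun y => y t) h
  have hS0 : S ⟨0, le_refl 0, hT.le⟩ = 0 := by
    rw [hS, intOp_apply]; simp
  have hST : S ⟨T, hT.le, le_refl T⟩ = 0 := by
    have := hp ⟨0, le_refl 0, hT.le⟩
    rw [hS0] at this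
    simpa [hT.ne'] using this
  have hx : ∀ t : Icc 0 T, x t = x ⟨0, le_refl 0, hT.le⟩ + α • S t := by
    intro t
    have := hp t
    rw [hST, smul_zero, add_zero, sub_eq_zero, sub_eq_iff_eq_add] at this
    rw [this, add_comm]
  have h0T : x ⟨0, le_refl 0, hT.le⟩ = x ⟨T, hT.le, le_refl T⟩ := by
    rw [hx ⟨T, hT.le, le_refl T⟩, hST]; simp
  have hint := int_sup_eq T hT.le f hg (α, x) (pext T hT x) (fun t ht => by
    rw [pext_of_mem T hT x h0T t ht, IccExtend_of_mem hT.le _ ht])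
  refine ⟨h0T, ?_, ?_⟩
  · rw [← hST]
    exact (hint ⟨T, hT.le, le_refl T⟩).symm
  · intro t ht
    rw [hx ⟨t, ht⟩]
    congr 2
    exact hint ⟨t, ht⟩

theorem Fmap_zero_deriv [CompleteSpace E] (T : ℝ) (hT : 0 < T) (f : ℝ → E → ℝ → E)
    (hf : Continuous (fun p : ℝ × E × ℝ => f p.1 p.2.1 p.2.2))
    (hper : ∀ t x α, f (t + T) x α = f t x α)
    (hg : Continuous (fun p : Icc 0 T × (E × ℝ) => f p.1 p.2.1 p.2.2))
    (α : ℝ) (x : C(Icc 0 T, E))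
    (h : Fmap T hT.le (fun k w => f k w.1 w.2) hg (α, x) = 0) (t : ℝ) :
    HasDerivAt (pext T hT x) (α • f t (pext T hT x t) α) t := by
  obtain ⟨h0, h1, h2⟩ := Fmap_zero T hT f hg α x h
  have hc : Continuous (fun s => f s (pext T hT x s) α) :=
    hf.comp (continuous_id.prodMk ((pext_cont T hT x h0).prodMk continuous_const))
  have hP : Function.Periodic (fun s => f s (pext T hT x s) α) T := by
    intro s
    simp only
    rw [pext_per, hper]
  have heq : pext T hT x = fun t => x ⟨0, le_refl 0, hT.le⟩ +
      α • ∫ s in (0:ℝ)..t, f s (pext T hT x s) α := by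
    apply per_eq T hT
    · exact pext_per T hT x
    · intro t
      rw [← intervalIntegral.integral_add_adjacent_intervals (hc.intervalIntegrable 0 t)
        (hc.intervalIntegrable t (t + T)), hP.intervalIntegral_add_eq t 0, zero_add, h1, add_zero]
    · intro t ht
      rw [pext_of_mem T hT x h0 t ht]
      exact h2 t ht
  have hd : HasDerivAt (fun t => x ⟨0, le_refl 0, hT.le⟩ +
      α • ∫ s in (0:ℝ)..t, f s (pext T hT x s) α) (α • f t (pext T hT x t) α) t :=
    ((intervalIntegral.integral_hasDerivAt_right (hc.intervalIntegrable 0 t)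
      (hc.stronglyMeasurableAtFilter _ _) hc.continuousAt).const_smul α).const_add _
  rw [← heq] at hd
  exact hd

theorem Fmap_of_sol [CompleteSpace E] (T : ℝ) (hT : 0 < T) (f : ℝ → E → ℝ → E)
    (hf : Continuous (fun p : ℝ × E × ℝ => f p.1 p.2.1 p.2.2))
    (hg : Continuous (fun p : Icc 0 T × (E × ℝ) => f p.1 p.2.1 p.2.2))
    (α : ℝ) (hα : α ≠ 0) (x : C(Icc 0 T, E)) (z : ℝ → E)
    (hz : ∀ t, HasDerivAt z (α • f t (z t) α) t) (hzT : ∀ t, z (t + T) = z t)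
    (hx : ∀ t : Icc 0 T, x t = z t) :
    Fmap T hT.le (fun k w => f k w.1 w.2) hg (α, x) = 0 := by
  have hzc : Continuous z := continuous_iff_continuousAt.2 fun t => (hz t).continuousAt
  have hc : Continuous (fun s => f s (z s) α) :=
    hf.comp (continuous_id.prodMk (hzc.prodMk continuous_const))
  have hint := int_sup_eq T hT.le f hg (α, x) z (fun t ht => by
    rw [IccExtend_of_mem hT.le _ ht]; exact (hx ⟨t, ht⟩).symm)
  have hftc : ∀ t, α • ∫ s in (0:ℝ)..t, f s (z s) α = z t - z 0 := by
    intro t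
    rw [← intervalIntegral.integral_smul]
    exact intervalIntegral.integral_eq_sub_of_hasDerivAt (fun s _ => hz s)
      ((hc.const_smul α).intervalIntegrable _ _)
  have hT0 : ∫ s in (0:ℝ)..T, f s (z s) α = 0 := by
    have := hftc T
    have h2 := hzT 0
    rw [zero_add] at h2
    rw [h2, sub_self] at this
    exact (smul_eq_zero.1 this).resolve_left hα
  ext1 t
  change x t - x ⟨0, le_refl 0, hT.le⟩
      - α • intOp T hT.le E (sup (fun k w => f k w.1 w.2) hg (α, x)) t
      + (1 / T) • intOp T hT.le E (sup (fun k w => f k w.1 w.2) hg (α, x))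
        ⟨T, hT.le, le_refl T⟩ = 0
  rw [hint, hint, hx, hx, hftc, hT0]
  simp

theorem bij_of_hyp (n : ℕ) (f₀ : (Fin n → ℝ) → (Fin n → ℝ)) (y : Fin n → ℝ)
    (h : ∀ μ ∈ spectrum ℂ ((jacobianMatrix n f₀ y).map Complex.ofReal), μ.re ≠ 0) :
    Function.Bijective (fderiv ℝ f₀ y) := by
  have h0 : (0:ℂ) ∉ spectrum ℂ ((jacobianMatrix n f₀ y).map Complex.ofReal) :=
    fun h1 => h 0 h1 rfl
  rw [spectrum.zero_notMem_iff, Matrix.isUnit_iff_isUnit_det] at h0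
  have h1 : ((jacobianMatrix n f₀ y).map Complex.ofReal).det
      = Complex.ofReal (jacobianMatrix n f₀ y).det :=
    (RingHom.map_det Complex.ofRealHom (jacobianMatrix n f₀ y)).symm
  have h2 : IsUnit (jacobianMatrix n f₀ y) := by
    rw [Matrix.isUnit_iff_isUnit_det, isUnit_iff_ne_zero]
    intro h3
    rw [h1, h3] at h0
    simp at h0
  have h3 : jacobianMatrix n f₀ y =
      LinearMap.toMatrix' (fderiv ℝ f₀ y : (Fin n → ℝ) →ₗ[ℝ] (Fin n → ℝ)) := by
    ext i j
    simp [jacobianMatrix, LinearMap.toMatrix'_apply]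
  have h4 : ⇑(fderiv ℝ f₀ y) = (jacobianMatrix n f₀ y).mulVec := by
    ext1 v
    rw [h3, LinearMap.toMatrix'_mulVec]; rfl
  rw [h4]
  exact ⟨Matrix.mulVec_injective_iff_isUnit.2 h2, Matrix.mulVec_surjective_iff_isUnit.2 h2⟩

/-- The mean, as a continuous linear functional. -/
noncomputable def meanL (T : ℝ) (hT : 0 ≤ T) (E : Type*)
    [NormedAddCommGroup E] [NormedSpace ℝ E] : C(Icc 0 T, E) →L[ℝ] E :=
  (1 / T) • (ContinuousMap.evalCLM ℝ (⟨T, hT, le_refl T⟩ : Icc (0:ℝ) T)).comp (intOp T hT E)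

theorem Fmap_hasStrict (T : ℝ) (hT : 0 ≤ T) (g : Icc 0 T → E × ℝ → E)
    (hg : Continuous (fun p : Icc 0 T × (E × ℝ) => g p.1 p.2))
    (v : E) (L : ℝ × C(Icc 0 T, E) →L[ℝ] C(Icc 0 T, E))
    (hL : HasStrictFDerivAt (sup g hg) L (0, constL _ E v)) :
    ∃ F' : ℝ × C(Icc 0 T, E) →L[ℝ] C(Icc 0 T, E),
      HasStrictFDerivAt (Fmap T hT g hg) F' (0, constL _ E v) ∧
      ∀ h, F' (0, h) = h - constL _ E (h ⟨0, le_refl 0, hT⟩) +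
        constL _ E (meanL T hT E (L (0, h))) := by
  have h1 : HasStrictFDerivAt (fun p : ℝ × C(Icc 0 T, E) => p.2)
      (ContinuousLinearMap.snd ℝ ℝ C(Icc 0 T, E)) (0, constL _ E v) := hasStrictFDerivAt_snd
  have h2 : HasStrictFDerivAt (fun p : ℝ × C(Icc 0 T, E) => p.1)
      (ContinuousLinearMap.fst ℝ ℝ C(Icc 0 T, E)) (0, constL _ E v) := hasStrictFDerivAt_fst
  have h3 := (((constL (Icc 0 T) E).comp (ContinuousMap.evalCLM ℝ
    (⟨0, le_refl 0, hT⟩ : Icc (0:ℝ) T))).hasStrictFDerivAt).comp (0, constL _ E v) h1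
  have h4 := h2.smul ((intOp T hT E).hasStrictFDerivAt.comp (0, constL _ E v) hL)
  have h5 := (((constL (Icc 0 T) E).comp (meanL T hT E)).hasStrictFDerivAt).comp
    (0, constL _ E v) hL
  refine ⟨_, ((h1.sub h3).sub h4).add h5, ?_⟩
  intro h
  ext k
  simp

theorem hasFDeriv_f₀ (T : ℝ) (hT : 0 < T) (f : ℝ → E → ℝ → E)
    (hg : Continuous (fun p : Icc 0 T × (E × ℝ) => f p.1 p.2.1 p.2.2))
    (v : E) (L : ℝ × C(Icc 0 T, E) →L[ℝ] C(Icc 0 T, E))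
    (hL : HasStrictFDerivAt (sup (fun (k : Icc 0 T) (w : E × ℝ) => f k w.1 w.2) hg) L (0, constL _ E v))
    (f₀ : E → E) (hf₀ : ∀ x, f₀ x = (1 / T) • ∫ t in (0:ℝ)..T, f t x 0) (w : E) :
    fderiv ℝ f₀ v w = meanL T hT.le E (L (0, constL _ E w)) := by
  have h1 : f₀ = fun x => meanL T hT.le E
      (sup (fun (k : Icc 0 T) (w : E × ℝ) => f k w.1 w.2) hg (0, constL _ E x)) := by
    ext1 x
    rw [hf₀]
    change _ = (1 / T) • intOp T hT.le E _ ⟨T, hT.le, le_refl T⟩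
    rw [int_sup_eq T hT.le f hg (0, constL _ E x) (fun _ => x) (fun t ht => by
      rw [IccExtend_of_mem hT.le _ ht]; rfl)]
  have h2 : HasFDerivAt (fun x : E => ((0:ℝ), constL (Icc 0 T) E x))
      ((ContinuousLinearMap.inr ℝ ℝ C(Icc 0 T, E)).comp (constL (Icc 0 T) E)) v :=
    ((ContinuousLinearMap.inr ℝ ℝ C(Icc 0 T, E)).comp (constL (Icc 0 T) E)).hasFDerivAt
  have h3 := (meanL T hT.le E).hasFDerivAt.comp v
    (HasFDerivAt.comp v (f := fun x : E => ((0:ℝ), constL (Icc 0 T) E x)) hL.hasFDerivAt h2)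
  rw [h1]
  exact congrArg (fun A : E →L[ℝ] E => A w) h3.fderiv

theorem main [CompleteSpace E] (T : ℝ) (hT : 0 < T) (f : ℝ → E → ℝ → E)
    (hf : ContDiff ℝ 2 (fun v : ℝ × E × ℝ => f v.1 v.2.1 v.2.2))
    (hper : ∀ t x α, f (t + T) x α = f t x α)
    (f₀ : E → E) (hf₀ : ∀ x, f₀ x = (1 / T) • ∫ t in (0:ℝ)..T, f t x 0)
    (ystar : E) (heq : f₀ ystar = 0) (hbij : Function.Bijective (fderiv ℝ f₀ ystar)) :
    ∃ α₀ > (0 : ℝ), ∃ N : Set E, IsOpen N ∧ ystar ∈ N ∧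
      ∃ X : ℝ → ℝ → E,
        ContinuousOn (fun q : ℝ × ℝ => X q.2 q.1) (univ ×ˢ Ioc 0 α₀) ∧
        (∀ α ∈ Ioc (0:ℝ) α₀,
          (∀ t, HasDerivAt (X α) (α • f t (X α t) α) t) ∧
          (∀ t, X α (t + T) = X α t) ∧
          (∀ t, X α t ∈ N) ∧
          (∀ z : ℝ → E,
            (∀ t, HasDerivAt z (α • f t (z t) α) t) →
            (∀ t, z (t + T) = z t) →
            (∀ t, z t ∈ N) → z = X α)) ∧
        TendstoUniformly X (fun _ => ystar) (𝓝[>] 0) := by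
  have hfc : Continuous (fun p : ℝ × E × ℝ => f p.1 p.2.1 p.2.2) := hf.continuous
  have hg : Continuous (fun p : Icc 0 T × (E × ℝ) => f p.1 p.2.1 p.2.2) :=
    hfc.comp ((continuous_subtype_val.comp continuous_fst).prodMk continuous_snd)
  set Fv := fun v : ℝ × E × ℝ => f v.1 v.2.1 v.2.2 with hFv
  set g' : Icc 0 T → E × ℝ → (E × ℝ →L[ℝ] E) := fun k w =>
    (fderiv ℝ Fv ((k : ℝ), w)).comp (ContinuousLinearMap.inr ℝ ℝ (E × ℝ)) with hg'def
  have hg' : Continuous (fun p : Icc 0 T × (E × ℝ) => g' p.1 p.2) := by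
    have h1 : Continuous (fderiv ℝ Fv) := hf.continuous_fderiv (by norm_num)
    exact (h1.comp ((continuous_subtype_val.comp continuous_fst).prodMk continuous_snd)).clm_comp
      continuous_const
  have hd : ∀ (k : Icc 0 T) (w : E × ℝ),
      HasFDerivAt (fun w : E × ℝ => f k w.1 w.2) (g' k w) w := by
    intro k w
    have h1 : HasFDerivAt Fv (fderiv ℝ Fv ((k : ℝ), w)) ((k : ℝ), w) :=
      (hf.differentiable (by norm_num) _).hasFDerivAt
    exact h1.comp w (hasFDerivAt_prodMk_right (k : ℝ) w)
  have hS := sup_hasStrict (fun (k : Icc 0 T) (w : E × ℝ) => f k w.1 w.2) hg g' hg' hd ystar 0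
  generalize mulOp (K := Icc 0 T) (E := E) (W := E) _ = L at hS
  obtain ⟨F', hF', hF'2⟩ := Fmap_hasStrict T hT.le _ hg ystar L hS
  have hinv : (F' ∘L .inr ℝ ℝ C(Icc 0 T, E)).IsInvertible := by
    have hb := bij (⟨0, le_refl 0, hT.le⟩ : Icc (0:ℝ) T)
      ((meanL T hT.le E).comp (L.comp (.inr ℝ ℝ C(Icc 0 T, E))))
      (by
        convert hbij using 1
        ext1 w
        exact (hasFDeriv_f₀ T hT f hg ystar L hS f₀ hf₀ w).symm)
      (F' ∘L .inr ℝ ℝ C(Icc 0 T, E)) (fun h => hF'2 h)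
    exact ⟨ContinuousLinearEquiv.ofBijective _ (LinearMap.ker_eq_bot.2 hb.1)
      (LinearMap.range_eq_top.2 hb.2), rfl⟩
  have hF0 : Fmap T hT.le (fun (k : Icc 0 T) (w : E × ℝ) => f k w.1 w.2) hg
      (0, constL _ E ystar) = 0 := by
    have hint := int_sup_eq T hT.le f hg (0, constL _ E ystar) (fun _ => ystar) (fun t ht => by
      rw [IccExtend_of_mem hT.le _ ht]; rfl)
    unfold Fmap
    rw [hint]
    change _ - _ - _ + constL _ E ((1 / T) • ∫ t in (0:ℝ)..T, f t ystar 0) = 0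
    rw [← hf₀, heq]
    ext k
    simp
  have hev := hF'.eventually_apply_eq_iff_implicitFunctionOfProdDomain hinv
  have hzero := hF'.eventually_apply_implicitFunctionOfProdDomain hinv
  have htend := hF'.tendsto_implicitFunctionOfProdDomain hinv
  obtain ⟨C, U, hU, hlip⟩ :=
    (hF'.hasStrictFDerivAt_implicitFunctionOfProdDomain hinv).exists_lipschitzOnWith
  generalize hF'.implicitFunctionOfProdDomain hinv = φ at hev hzero htend hlip
  rw [hF0] at hev hzero
  simp only at hU htend hzero
  obtain ⟨r, hr, hball⟩ := Metric.eventually_nhds_iff_ball.1 hev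
  have hα := hzero.and ((htend.eventually (Metric.ball_mem_nhds _ hr)).and hU)
  obtain ⟨a, ha, haball⟩ := Metric.eventually_nhds_iff_ball.1 hα
  -- bounds on the parameter
  set α₀ := min (a / 2) (r / 2) with hα₀
  have hα₀pos : 0 < α₀ := lt_min (by positivity) (by positivity)
  have hmem : ∀ α ∈ Ioc 0 α₀, α ∈ Metric.ball (0:ℝ) a ∧ α ∈ Metric.ball (0:ℝ) r := by
    intro α hα
    have h1 : α ≤ a / 2 := hα.2.trans (min_le_left _ _)
    have h2 : α ≤ r / 2 := hα.2.trans (min_le_right _ _)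
    simp only [Metric.mem_ball, dist_zero_right, Real.norm_eq_abs, abs_of_pos hα.1]
    constructor <;> linarith
  have hdist : ∀ α ∈ Ioc 0 α₀, ∀ z : C(Icc 0 T, E), z ∈ Metric.ball (constL _ E ystar) r →
      (Fmap T hT.le (fun (k : Icc 0 T) (w : E × ℝ) => f k w.1 w.2) hg (α, z) = 0 ↔ φ α = z) := by
    intro α hα z hz
    apply hball (α, z)
    rw [← ball_prod_same]
    exact ⟨(hmem α hα).2, hz⟩
  have hF : ∀ α ∈ Ioc 0 α₀, Fmap T hT.le (fun (k : Icc 0 T) (w : E × ℝ) => f k w.1 w.2) hg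
      (α, φ α) = 0 := fun α hα => (haball α (hmem α hα).1).1
  have hpd : ∀ (x y : C(Icc 0 T, E)) (t : ℝ), dist (pext T hT x t) (pext T hT y t) ≤ dist x y :=
    fun x y t => ContinuousMap.dist_apply_le_dist _
  refine ⟨α₀, hα₀pos, Metric.ball ystar r, Metric.isOpen_ball, Metric.mem_ball_self hr,
    fun α => pext T hT (φ α), ?_, ?_, ?_⟩
  · rintro ⟨t, α⟩ ⟨-, hα⟩
    have hφ : ContinuousWithinAt φ (Ioc 0 α₀) α := by
      refine (hlip.continuousOn.mono ?_) α hα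
      intro β hβ
      exact (haball β (hmem β hβ).1).2.2
    have hc : Continuous (pext T hT (φ α)) :=
      pext_cont T hT _ (Fmap_zero T hT f hg α (φ α) (hF α hα)).1
    rw [Metric.continuousWithinAt_iff'] at hφ ⊢
    intro ε hε
    have e1 := hφ (ε / 2) (by positivity)
    have e2 := Metric.continuousAt_iff'.1 (hc.continuousAt (x := t)) (ε / 2) (by positivity)
    rw [nhdsWithin_prod_eq, nhdsWithin_univ]
    filter_upwards [e2.prod_mk e1] with q hq
    have := dist_triangle (pext T hT (φ q.2) q.1) (pext T hT (φ α) q.1) (pext T hT (φ α) t)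
    have h2 := hpd (φ q.2) (φ α) q.1
    linarith [hq.1, hq.2]
  · intro α hα
    refine ⟨Fmap_zero_deriv T hT f hfc hper hg α (φ α) (hF α hα), pext_per T hT _, ?_, ?_⟩
    · intro t
      have h1 := (haball α (hmem α hα).1).2.1
      rw [Metric.mem_ball]
      exact (hpd (φ α) (constL _ E ystar) t).trans_lt h1
    · intro z hz hzT hzN
      have hzc : Continuous z := continuous_iff_continuousAt.2 fun t => (hz t).continuousAt
      let x : C(Icc 0 T, E) := ⟨fun t => z t, hzc.comp continuous_subtype_val⟩
      have hx0 := Fmap_of_sol T hT f hfc hg α hα.1.ne' x z hz hzT (fun t => rfl)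
      have hxb : x ∈ Metric.ball (constL (Icc 0 T) E ystar) r := by
        rw [Metric.mem_ball, ContinuousMap.dist_lt_iff hr]
        intro t
        exact hzN t
      have hφx := (hdist α hα x hxb).1 hx0
      simp only [hφx]
      refine per_eq T hT _ _ hzT (pext_per T hT x) ?_
      intro t ht
      rw [pext_of_mem T hT x ?_ t ht]
      · rfl
      · change z 0 = z T
        have := hzT 0
        rw [zero_add] at this
        exact this.symm
  · rw [Metric.tendstoUniformly_iff]
    intro ε hε
    have h1 : ∀ᶠ α in 𝓝[>] (0:ℝ), dist (φ α) (constL _ E ystar) < ε :=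
      (htend.mono_left nhdsWithin_le_nhds).eventually (Metric.ball_mem_nhds _ hε)
    filter_upwards [h1] with α hα t
    rw [dist_comm]
    exact (hpd (φ α) (constL _ E ystar) t).trans_lt hα

end AvgAux

/-- If `y*` is a hyperbolic equilibrium of the averaged system
`y' = α f₀(y)`, then for every small `α > 0` the equation `x' = α f(t,x,α)` has a
unique `T`-periodic solution near `y*`, continuous in `(t, α)` and converging
uniformly to `y*` as `α → 0⁺`. -/
theorem averaging_periodic_solution_near_hyperbolic_equilibrium
    (n : ℕ) (hn : 1 ≤ n) (T : ℝ) (hT : 0 < T)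
    (f : ℝ → (Fin n → ℝ) → ℝ → (Fin n → ℝ))
    (hf : ContDiff ℝ 2 (fun v : ℝ × (Fin n → ℝ) × ℝ => f v.1 v.2.1 v.2.2))
    (hper : ∀ t x α, f (t + T) x α = f t x α)
    (f₀ : (Fin n → ℝ) → (Fin n → ℝ))
    (hf₀ : ∀ x, f₀ x = (1 / T) • ∫ t in (0:ℝ)..T, f t x 0)
    (ystar : Fin n → ℝ)
    (heq : f₀ ystar = 0)
    (hhyp : ∀ μ ∈ spectrum ℂ ((jacobianMatrix n f₀ ystar).map Complex.ofReal),
      μ.re ≠ 0) :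
    ∃ α₀ > (0 : ℝ), ∃ N : Set (Fin n → ℝ), IsOpen N ∧ ystar ∈ N ∧
      ∃ X : ℝ → ℝ → (Fin n → ℝ),
        ContinuousOn (fun q : ℝ × ℝ => X q.2 q.1) (univ ×ˢ Ioc 0 α₀) ∧
        (∀ α ∈ Ioc (0:ℝ) α₀,
          (∀ t, HasDerivAt (X α) (α • f t (X α t) α) t) ∧
          (∀ t, X α (t + T) = X α t) ∧
          (∀ t, X α t ∈ N) ∧
          (∀ z : ℝ → Fin n → ℝ,
            (∀ t, HasDerivAt z (α • f t (z t) α) t) →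
            (∀ t, z (t + T) = z t) →
            (∀ t, z t ∈ N) → z = X α)) ∧
        TendstoUniformly X (fun _ => ystar) (𝓝[>] 0) := by
  exact AvgAux.main T hT f hf hper f₀ hf₀ ystar heq (AvgAux.bij_of_hyp n f₀ ystar hhyp)
end
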